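/- arXiv:1609.06247 — 2 statements merged into one kernel-verified Lean document; each statement's English description precedes it below -/
import Mathlib

section
/- For m = 1, the spectral arc of the complex Lamé operator L = −d²/dx² + 2ω²℘(ωx+z₀) that extends to infinity is asymptotic to the positive real half-line shifted by −2ηω: along this arc, λ = 1/s² − 2ηω + O(s²) as s → 0, for a real parameter s parameterizing the arc near infinity. -/
open Complex Set Filter

noncomputable section

/-- The period lattice with half-periods `w1`, `w3`, i.e. the set of all
`2 m w1 + 2 n w3` with `m n : ℤ`. -/
def latticeSet (w1 w3 : ℂ) : Set ℂ := {z | ∃ m n : ℤ, z = 2 * m * w1 + 2 * n * w3}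

/-- Weierstrass data for a lattice `𝓛` with basic half-periods `w1`, `w3`:
the functions `℘` (denoted `P`), `ζ` (denoted `Z`) and `σ` (denoted `S`),
characterized up to uniqueness by their standard analytic properties:
`℘` is `𝓛`-periodic, holomorphic off `𝓛`, with `℘(z) - 1/z² → 0` as `z → 0`;
`ζ` is odd with `ζ' = -℘`; `σ` is entire, non-vanishing off `𝓛`, with
`σ'/σ = ζ` and `σ(z)/z → 1` as `z → 0`. -/
structure WeierstrassData where
  w1 : ℂ
  w3 : ℂ
  P : ℂ → ℂ
  Z : ℂ → ℂ
  S : ℂ → ℂ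
  w1_ne : w1 ≠ 0
  indep : ∀ r : ℝ, w3 ≠ (r : ℂ) * w1
  P_diff : ∀ z ∉ latticeSet w1 w3, DifferentiableAt ℂ P z
  P_periodic : ∀ w ∈ latticeSet w1 w3, ∀ z, P (z + w) = P z
  P_pole : Tendsto (fun z => P z - 1 / z ^ 2) (nhdsWithin 0 {(0 : ℂ)}ᶜ) (nhds 0)
  Z_diff : ∀ z ∉ latticeSet w1 w3, DifferentiableAt ℂ Z z
  Z_deriv : ∀ z ∉ latticeSet w1 w3, deriv Z z = -P z
  Z_odd : ∀ z, Z (-z) = -Z z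
  S_diff : Differentiable ℂ S
  S_ne : ∀ z ∉ latticeSet w1 w3, S z ≠ 0
  S_deriv : ∀ z ∉ latticeSet w1 w3, deriv S z = Z z * S z
  S_norm : Tendsto (fun z => S z / z) (nhdsWithin 0 {(0 : ℂ)}ᶜ) (nhds 1)

namespace WeierstrassData

variable (W : WeierstrassData)

/-- The period lattice of `W`. -/
def lattice : Set ℂ := latticeSet W.w1 W.w3

/-- The third basic half-period `ω₂ = ω₁ + ω₃`. -/
def w2 : ℂ := W.w1 + W.w3

/-- `e₁ = ℘(ω₁)`. -/
def e1 : ℂ := W.P W.w1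
/-- `e₂ = ℘(ω₂)`. -/
def e2 : ℂ := W.P W.w2
/-- `e₃ = ℘(ω₃)`. -/
def e3 : ℂ := W.P W.w3

/-- The Rofe-Beketov spectrum of the complex Lamé operator
`L = -d²/dx² + m(m+1) ω² ℘(ωx + z₀)` in `L²(ℝ)`: the set of `λ ∈ ℂ` for which
the equation `Lψ = λψ` has a nonzero bounded solution on the whole real line. -/
def lameSpectrum (m : ℕ) (ω z0 : ℂ) : Set ℂ :=
  {lam | ∃ φ : ℝ → ℂ, φ ≠ 0 ∧ ContDiff ℝ 2 φ ∧
    (∀ x : ℝ, -deriv (deriv φ) x + (m * (m + 1) : ℂ) * ω ^ 2 * W.P (ω * x + z0) * φ x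
      = lam * φ x) ∧ ∃ C : ℝ, ∀ x : ℝ, ‖φ x‖ ≤ C}

/-- The function `u(k) = Re[η k - ω ζ(k)]`, where `η = ζ(ω)`. -/
def uFun (ω : ℂ) : ℂ → ℝ := fun k => (W.Z ω * k - ω * W.Z k).re

/-- The function `v(k) = Im[η k - ω ζ(k)]`, where `η = ζ(ω)`. -/
def vFun (ω : ℂ) : ℂ → ℝ := fun k => (W.Z ω * k - ω * W.Z k).im

end WeierstrassData




open scoped Topology

namespace WeierstrassData

lemma lattice_indep (W : WeierstrassData) : LinearIndependent ℝ ![2 * W.w1, 2 * W.w3] := by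
  rw [LinearIndependent.pair_iff]
  intro s t h
  simp only [real_smul] at h
  have ht : t = 0 := by
    by_contra ht
    apply W.indep (-s / t)
    have : (t : ℂ) ≠ 0 := by exact_mod_cast ht
    push_cast
    field_simp
    linear_combination h / 2
  subst ht
  have := W.w1_ne
  simpa [this] using h

/-- The associated Mathlib period pair. -/
def pp (W : WeierstrassData) : PeriodPair := ⟨2 * W.w1, 2 * W.w3, W.lattice_indep⟩

lemma mem_pp (W : WeierstrassData) {z : ℂ} : z ∈ W.pp.lattice ↔ z ∈ W.lattice := by
  rw [PeriodPair.mem_lattice]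
  simp only [pp, lattice, latticeSet, mem_ofPred_eq]
  constructor
  · rintro ⟨m, n, h⟩
    exact ⟨m, n, by rw [← h]; ring⟩
  · rintro ⟨m, n, h⟩
    exact ⟨m, n, by rw [h]; ring⟩

lemma coe_pp (W : WeierstrassData) : (W.pp.lattice : Set ℂ) = W.lattice := by
  ext z; exact W.mem_pp

lemma add_mem (W : WeierstrassData) {z w : ℂ} (hz : z ∈ W.lattice) (hw : w ∈ W.lattice) :
    z + w ∈ W.lattice := by
  rw [← mem_pp] at *; exact Submodule.add_mem _ hz hw

lemma neg_mem_iff (W : WeierstrassData) {z : ℂ} : -z ∈ W.lattice ↔ z ∈ W.lattice := by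
  simp [← mem_pp]

lemma zero_mem (W : WeierstrassData) : (0 : ℂ) ∈ W.lattice := by
  simp [← mem_pp]

lemma add_mem_iff (W : WeierstrassData) {z w : ℂ} (hw : w ∈ W.lattice) :
    z + w ∈ W.lattice ↔ z ∈ W.lattice := by
  refine ⟨fun h => ?_, fun h => W.add_mem h hw⟩
  have := W.add_mem h (W.neg_mem_iff.2 hw)
  simpa using this

lemma isClosed_lat (W : WeierstrassData) : IsClosed W.lattice := by
  rw [← coe_pp]; exact W.pp.isClosed_lattice

lemma isOpen_compl (W : WeierstrassData) : IsOpen W.latticeᶜ := W.isClosed_lat.isOpen_compl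

lemma countable_lat (W : WeierstrassData) : W.lattice.Countable := by
  rw [← coe_pp]; exact countable_of_Lindelof_of_discrete (X := W.pp.lattice)

lemma preconn (W : WeierstrassData) : IsPreconnected W.latticeᶜ :=
  (W.countable_lat.isConnected_compl_of_one_lt_rank (by simp)).2

/-- punctured neighbourhoods avoid the lattice -/
lemma eventually_notMem (W : WeierstrassData) (c : ℂ) : ∀ᶠ z in 𝓝[≠] c, z ∉ W.lattice := by
  have := W.pp.compl_lattice_sdiff_singleton_mem_nhds c
  rw [coe_pp] at this
  rw [eventually_nhdsWithin_iff]
  filter_upwards [this] with z hz hzc hzl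
  exact hz ⟨hzl, hzc⟩

lemma ev_notMem (W : WeierstrassData) {c : ℂ} (hc : c ∉ W.lattice) :
    ∀ᶠ z in 𝓝 c, z ∉ W.lattice := W.isOpen_compl.mem_nhds hc

lemma hasDerivAt_Z (W : WeierstrassData) {z : ℂ} (hz : z ∉ W.lattice) :
    HasDerivAt W.Z (-W.P z) z := by
  rw [← W.Z_deriv z hz]; exact (W.Z_diff z hz).hasDerivAt

lemma hasDerivAt_S (W : WeierstrassData) {z : ℂ} (hz : z ∉ W.lattice) :
    HasDerivAt W.S (W.Z z * W.S z) z := by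
  rw [← W.S_deriv z hz]; exact (W.S_diff z).hasDerivAt

lemma P_add (W : WeierstrassData) {w : ℂ} (hw : w ∈ W.lattice) (z : ℂ) :
    W.P (z + w) = W.P z := W.P_periodic w hw z

lemma P_even (W : WeierstrassData) {z : ℂ} (hz : z ∉ W.lattice) : W.P (-z) = W.P z := by
  have h1 := W.hasDerivAt_Z hz
  have hz' : -z ∉ W.lattice := by rwa [neg_mem_iff]
  have h2 := ((W.hasDerivAt_Z hz').comp z (hasDerivAt_neg z)).neg
  have h3 : (-(W.Z ∘ Neg.neg)) = W.Z := by
    funext w; simp [W.Z_odd]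
  rw [h3] at h2
  have := h1.unique h2
  linear_combination this

lemma Z_add (W : WeierstrassData) {w : ℂ} (hw : w ∈ W.lattice) :
    ∃ c, ∀ z ∉ W.lattice, W.Z (z + w) = W.Z z + c := by
  have hd : ∀ z ∉ W.lattice, HasDerivAt (fun z => W.Z (z + w)) (-W.P z) z := by
    intro z hz
    have hz' : z + w ∉ W.lattice := by rwa [W.add_mem_iff hw]
    have := (W.hasDerivAt_Z hz').comp_add_const z w
    rwa [W.P_add hw] at this
  obtain ⟨a, ha⟩ := W.isOpen_compl.exists_eq_add_of_deriv_eq W.preconn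
    (f := fun z => W.Z (z + w)) (g := W.Z)
    (fun z hz => (hd z hz).differentiableAt.differentiableWithinAt)
    (fun z hz => (W.hasDerivAt_Z hz).differentiableAt.differentiableWithinAt)
    (fun z hz => by rw [(hd z hz).deriv, (W.hasDerivAt_Z hz).deriv])
  exact ⟨a, fun z hz => ha hz⟩

lemma Z_add_two (W : WeierstrassData) {ω : ℂ} (hω : 2 * ω ∈ W.lattice) (hω' : ω ∉ W.lattice)
    {z : ℂ} (hz : z ∉ W.lattice) : W.Z (z + 2 * ω) = W.Z z + 2 * W.Z ω := by
  obtain ⟨c, hc⟩ := W.Z_add hω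
  have h1 := hc (-ω) (by rwa [neg_mem_iff])
  rw [show -ω + 2 * ω = ω by ring, W.Z_odd] at h1
  rw [hc z hz]
  linear_combination -h1

lemma S_add_two (W : WeierstrassData) {ω : ℂ} (hω : 2 * ω ∈ W.lattice) (hω' : ω ∉ W.lattice) :
    ∃ C : ℂ, C ≠ 0 ∧
      ∀ z ∉ W.lattice, W.S (z + 2 * ω) = C * exp (2 * W.Z ω * z) * W.S z := by
  have hd : ∀ z ∉ W.lattice,
      HasDerivAt (fun z => W.S (z + 2 * ω) * exp (-(2 * W.Z ω * z)) / W.S z) 0 z := by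
    intro z hz
    have hz' : z + 2 * ω ∉ W.lattice := by rwa [W.add_mem_iff hω]
    have h1 := (W.hasDerivAt_S hz').comp_add_const z (2 * ω)
    have h2 : HasDerivAt (fun z => exp (-(2 * W.Z ω * z)))
        (exp (-(2 * W.Z ω * z)) * (-(2 * W.Z ω * 1))) z :=
      (((hasDerivAt_id z).const_mul (2 * W.Z ω)).neg).cexp
    have hS := W.S_ne z hz
    refine ((h1.mul h2).div (W.hasDerivAt_S hz) hS).congr_deriv ?_
    rw [W.Z_add_two hω hω' hz]
    simp only [Pi.mul_apply]
    rw [div_eq_zero_iff]; left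
    ring
  obtain ⟨a, ha⟩ := W.isOpen_compl.exists_is_const_of_deriv_eq_zero W.preconn
    (fun z hz => (hd z hz).differentiableAt.differentiableWithinAt)
    (fun z hz => (hd z hz).deriv)
  have key : ∀ z ∉ W.lattice, W.S (z + 2 * ω) = a * exp (2 * W.Z ω * z) * W.S z := by
    intro z hz
    have := ha z hz
    have hS := W.S_ne z hz
    rw [div_eq_iff hS] at this
    calc W.S (z + 2 * ω) = W.S (z + 2 * ω) * exp (-(2 * W.Z ω * z)) * exp (2 * W.Z ω * z) := by
          rw [mul_assoc, ← Complex.exp_add]; simp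
      _ = _ := by rw [this]; ring
  refine ⟨a, ?_, key⟩
  rintro rfl
  have := key ω hω'
  refine W.S_ne (ω + 2 * ω) (by change _ ∉ W.lattice; rwa [W.add_mem_iff hω]) ?_
  rw [this]; simp

/-- Local expansion of `ζ` at `0`. -/
lemma exists_h (W : WeierstrassData) : ∃ h : ℂ → ℂ, AnalyticAt ℂ h 0 ∧ h 0 = 0 ∧
    deriv h 0 = 0 ∧ deriv (deriv h) 0 = 0 ∧
    (∀ᶠ z in 𝓝[≠] (0 : ℂ), W.Z z = 1 / z + h z) ∧
    (∀ᶠ z in 𝓝[≠] (0 : ℂ), W.P z = 1 / z ^ 2 - deriv h z) := by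
  -- S 0 = 0
  have hS0 : W.S 0 = 0 := by
    have h1 : Tendsto (fun z : ℂ => W.S z / z * z) (𝓝[≠] 0) (𝓝 (1 * 0)) :=
      W.S_norm.mul (tendsto_id.mono_left nhdsWithin_le_nhds)
    have h2 : Tendsto W.S (𝓝[≠] 0) (𝓝 (W.S 0)) :=
      (W.S_diff 0).continuousAt.tendsto.mono_left nhdsWithin_le_nhds
    have h3 : Tendsto W.S (𝓝[≠] 0) (𝓝 (1 * 0)) := by
      refine h1.congr' ?_
      filter_upwards [self_mem_nhdsWithin] with z hz
      exact div_mul_cancel₀ _ hz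
    simpa using tendsto_nhds_unique h2 h3
  set q : ℂ → ℂ := dslope W.S 0 with hq
  have hqd : Differentiable ℂ q := by
    rw [← differentiableOn_univ, Complex.differentiableOn_dslope univ_mem, differentiableOn_univ]
    exact W.S_diff
  have hSq : ∀ z, W.S z = z * q z := by
    intro z
    have := sub_smul_dslope W.S 0 z
    simp [hS0] at this
    exact this.symm
  have hq0 : q 0 = 1 := by
    have h2 : Tendsto q (𝓝[≠] 0) (𝓝 (q 0)) :=
      (hqd 0).continuousAt.tendsto.mono_left nhdsWithin_le_nhds
    have h3 : Tendsto q (𝓝[≠] 0) (𝓝 1) := by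
      refine W.S_norm.congr' ?_
      filter_upwards [self_mem_nhdsWithin] with z hz
      rw [hSq, mul_div_cancel_left₀ _ hz]
    exact tendsto_nhds_unique h2 h3
  have hqa : AnalyticAt ℂ q 0 := hqd.analyticAt 0
  set h : ℂ → ℂ := fun z => deriv q z / q z with hh
  have hha : AnalyticAt ℂ h 0 := hqa.deriv.div hqa (by simp [hq0])
  have hqne : ∀ᶠ z in 𝓝[≠] (0 : ℂ), q z ≠ 0 :=
    ((hqd 0).continuousAt.eventually_ne (by simp [hq0])).filter_mono nhdsWithin_le_nhds
  have hZ : ∀ᶠ z in 𝓝[≠] (0 : ℂ), W.Z z = 1 / z + h z := by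
    filter_upwards [hqne, self_mem_nhdsWithin, W.eventually_notMem 0] with z hqz hz hzl
    have hz : z ≠ 0 := hz
    have h1 := W.hasDerivAt_S hzl
    have h2 : HasDerivAt W.S (1 * q z + z * deriv q z) z := by
      have := (hasDerivAt_id z).mul (hqd z).hasDerivAt
      have e : (id * q) = W.S := by funext w; simp [hSq]
      rwa [e] at this
    have h3 := h1.unique h2
    rw [hSq] at h3
    simp only [hh]
    field_simp
    linear_combination h3
  -- derivative
  have hP : ∀ᶠ z in 𝓝[≠] (0 : ℂ), W.P z = 1 / z ^ 2 - deriv h z := by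
    have h1 : ∀ᶠ z in 𝓝[≠] (0 : ℂ), ∀ᶠ y in 𝓝 z, W.Z y = 1 / y + h y := by
      rw [eventually_eventually_nhdsWithin.symm] at hZ
      filter_upwards [hZ, self_mem_nhdsWithin] with z hz hz0
      rwa [(isOpen_compl_singleton.nhdsWithin_eq hz0)] at hz
    filter_upwards [h1, self_mem_nhdsWithin, W.eventually_notMem 0,
      hha.eventually_analyticAt.filter_mono nhdsWithin_le_nhds] with z h1 hz hzl hza
    have hz : z ≠ 0 := hz
    have h2 := (W.hasDerivAt_Z hzl)
    have h3 : HasDerivAt (fun y => 1 / y + h y) (-(z ^ 2)⁻¹ + deriv h z) z := by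
      simp only [one_div]
      exact (hasDerivAt_inv hz).add hza.differentiableAt.hasDerivAt
    have h4 := h2.unique (h3.congr_of_eventuallyEq h1)
    rw [one_div]
    linear_combination -h4
  -- oddness
  have hneg : Tendsto (fun z : ℂ => -z) (𝓝[≠] 0) (𝓝[≠] 0) := by
    have : Tendsto (fun z : ℂ => -z) (𝓝 0) (𝓝 0) := by
      simpa using (continuous_neg (G := ℂ)).tendsto 0
    refine tendsto_nhdsWithin_iff.2 ⟨this.mono_left nhdsWithin_le_nhds, ?_⟩
    filter_upwards [self_mem_nhdsWithin] with z hz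
    simpa using hz
  have hodd : ∀ᶠ z in 𝓝[≠] (0 : ℂ), h (-z) = - h z := by
    filter_upwards [hZ, hneg.eventually hZ] with z h1 h2
    rw [W.Z_odd, h1, one_div, one_div, inv_neg] at h2
    linear_combination -h2
  have h0 : h 0 = 0 := by
    have t1 : Tendsto (fun z => h (-z)) (𝓝[≠] 0) (𝓝 (h 0)) :=
      (hha.continuousAt.tendsto.mono_left nhdsWithin_le_nhds).comp hneg
    have t2 : Tendsto (fun z => - h z) (𝓝[≠] 0) (𝓝 (- h 0)) :=
      (hha.continuousAt.tendsto.mono_left nhdsWithin_le_nhds).neg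
    have := tendsto_nhds_unique (t1.congr' hodd) t2
    linear_combination this / 2
  have hd0 : deriv h 0 = 0 := by
    have t1 : Tendsto (fun z => deriv h z) (𝓝[≠] 0) (𝓝 (deriv h 0)) :=
      (hha.deriv.continuousAt.tendsto.mono_left nhdsWithin_le_nhds)
    have t2 : Tendsto (fun z => -(W.P z - 1 / z ^ 2)) (𝓝[≠] 0) (𝓝 (-0)) := W.P_pole.neg
    have t3 : Tendsto (fun z => deriv h z) (𝓝[≠] 0) (𝓝 (-0)) := by
      refine t2.congr' ?_
      filter_upwards [hP] with z hz
      rw [hz]; ring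
    simpa using tendsto_nhds_unique t1 t3
  have hdd : deriv (deriv h) 0 = 0 := by
    have heven : ∀ᶠ z in 𝓝 (0 : ℂ), deriv h (-z) = deriv h z := by
      rw [← nhdsNE_sup_pure, eventually_sup]
      refine ⟨?_, by simp⟩
      filter_upwards [hP, hneg.eventually hP, W.eventually_notMem 0] with z h1 h2 hzl
      rw [W.P_even hzl, h1] at h2
      linear_combination h2
    have h1 : HasDerivAt (fun z => deriv h z) (deriv (deriv h) (-0) * (-1)) 0 := by
      have hda : HasDerivAt (deriv h) (deriv (deriv h) (-0)) (-0) := by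
        rw [neg_zero]; exact hha.deriv.differentiableAt.hasDerivAt
      refine (hda.comp 0 (hasDerivAt_neg 0)).congr_of_eventuallyEq ?_
      filter_upwards [heven] with z hz
      exact hz.symm
    have h2 := hha.deriv.differentiableAt.hasDerivAt.unique h1
    rw [neg_zero] at h2
    linear_combination h2 / 2
  exact ⟨h, hha, h0, hd0, hdd, hZ, hP⟩

end WeierstrassData
namespace WeierstrassData

open Classical in
/-- Auxiliary function for the addition identity. -/
def addG (W : WeierstrassData) (k z : ℂ) : ℂ :=
  if z ∈ W.lattice ∨ z - k ∈ W.lattice then 0 else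
    (W.Z (z - k) - W.Z z + W.Z k) ^ 2 - W.P z - W.P (z - k) - W.P k

lemma addG_add (W : WeierstrassData) (k : ℂ) {w : ℂ} (hw : w ∈ W.lattice) (z : ℂ) :
    W.addG k (z + w) = W.addG k z := by
  obtain ⟨c, hc⟩ := W.Z_add hw
  have e : z + w - k = (z - k) + w := by ring
  unfold addG
  rw [e, W.add_mem_iff hw, W.add_mem_iff hw]
  split_ifs with h
  · rfl
  · push Not at h
    rw [hc _ h.1, hc _ h.2, W.P_add hw, W.P_add hw]
    ring

lemma addG_symm (W : WeierstrassData) (k z : ℂ) : W.addG k (k - z) = W.addG k z := by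
  have e : k - z - k = -z := by ring
  have e2 : k - z = -(z - k) := by ring
  unfold addG
  rw [e, e2, W.neg_mem_iff, W.neg_mem_iff]
  by_cases h1 : z ∈ W.lattice
  · simp [h1]
  by_cases h2 : z - k ∈ W.lattice
  · simp [h2]
  simp only [h1, h2, or_self, if_false]
  rw [W.Z_odd, W.Z_odd, W.P_even h1, W.P_even h2]
  ring

lemma addG_diff (W : WeierstrassData) (k : ℂ) {z : ℂ} (h1 : z ∉ W.lattice)
    (h2 : z - k ∉ W.lattice) : DifferentiableAt ℂ (W.addG k) z := by
  have hc : ContinuousAt (fun z : ℂ => z - k) z := by fun_prop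
  have : W.addG k =ᶠ[𝓝 z]
      fun z => (W.Z (z - k) - W.Z z + W.Z k) ^ 2 - W.P z - W.P (z - k) - W.P k := by
    filter_upwards [W.ev_notMem h1, hc.eventually (W.ev_notMem h2)] with y hy1 hy2
    simp [addG, hy1, hy2]
  refine DifferentiableAt.congr_of_eventuallyEq ?_ this
  have a1 := W.Z_diff z h1
  have a2 := W.P_diff z h1
  have a3 : DifferentiableAt ℂ (fun z => W.Z (z - k)) z :=
    (W.Z_diff _ h2).comp z (differentiableAt_id.sub_const k)
  have a4 : DifferentiableAt ℂ (fun z => W.P (z - k)) z :=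
    (W.P_diff _ h2).comp z (differentiableAt_id.sub_const k)
  fun_prop

lemma addG_ev_diff (W : WeierstrassData) (k c : ℂ) :
    ∀ᶠ z in 𝓝[≠] c, DifferentiableAt ℂ (W.addG k) z := by
  have ht : Tendsto (fun z : ℂ => z - k) (𝓝[≠] c) (𝓝[≠] (c - k)) := by
    refine tendsto_nhdsWithin_iff.2 ⟨?_, ?_⟩
    · have : ContinuousAt (fun z : ℂ => z - k) c := by fun_prop
      exact this.tendsto.mono_left nhdsWithin_le_nhds
    · filter_upwards [self_mem_nhdsWithin] with z hz
      simpa [sub_left_inj] using hz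
  filter_upwards [W.eventually_notMem c, ht.eventually (W.eventually_notMem (c - k))]
    with z h1 h2
  exact W.addG_diff k h1 h2

lemma addG_cont_zero (W : WeierstrassData) {k : ℂ} (hk : k ∉ W.lattice) :
    ContinuousAt (W.addG k) 0 := by
  obtain ⟨h, hha, h0, hd0, -, hZ, -⟩ := W.exists_h
  have hk' : (0 : ℂ) - k ∉ W.lattice := by rwa [zero_sub, W.neg_mem_iff]
  rw [continuousAt_iff_punctured_nhds]
  have g0 : W.addG k 0 = 0 := by simp [addG, W.zero_mem]
  rw [g0]
  set A : ℂ → ℂ := fun z => W.Z (z - k) + W.Z k - h z with hA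
  have hAd : HasDerivAt A (-W.P k) 0 := by
    have a1 : HasDerivAt (fun z => W.Z (z - k)) (-W.P (0 - k)) 0 :=
      (W.hasDerivAt_Z hk').comp_sub_const 0 k
    have a2 := (a1.add_const (W.Z k)).sub hha.differentiableAt.hasDerivAt
    rw [hd0, sub_zero, zero_sub, W.P_even hk] at a2
    exact a2
  have hA0 : A 0 = 0 := by simp [hA, h0, W.Z_odd]
  have t1 : Tendsto (fun z => A z / z) (𝓝[≠] 0) (𝓝 (-W.P k)) := by
    have := hAd.tendsto_slope_zero
    simpa [hA0, div_eq_inv_mul] using this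
  have t2 : Tendsto A (𝓝[≠] 0) (𝓝 0) := by
    have := hAd.continuousAt.tendsto
    rw [hA0] at this
    exact this.mono_left nhdsWithin_le_nhds
  have t3 : Tendsto (fun z => W.P (z - k)) (𝓝[≠] 0) (𝓝 (W.P k)) := by
    have a4 : ContinuousAt (fun z => W.P (z - k)) 0 :=
      ((W.P_diff _ hk').comp (0 : ℂ) (differentiableAt_id.sub_const k)).continuousAt
    have := a4.tendsto.mono_left (nhdsWithin_le_nhds (s := {(0 : ℂ)}ᶜ))
    simpa [W.P_even hk] using this
  have t4 := ((((t2.pow 2).sub (t1.const_mul 2)).sub W.P_pole).sub t3).sub_const (W.P k)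
  have e : (0 : ℂ) ^ 2 - 2 * -W.P k - 0 - W.P k - W.P k = 0 := by ring
  rw [e] at t4
  refine t4.congr' ?_
  have hc : ContinuousAt (fun z : ℂ => z - k) 0 := by fun_prop
  filter_upwards [W.eventually_notMem 0, hZ, self_mem_nhdsWithin,
    (hc.eventually (W.ev_notMem hk')).filter_mono nhdsWithin_le_nhds] with z h1 h2 hz h3
  have hz : z ≠ 0 := hz
  simp only [addG, h1, h3, or_self, if_false, hA]
  rw [h2]
  field_simp
  ring

lemma addG_cont (W : WeierstrassData) {k : ℂ} (hk : k ∉ W.lattice) (c : ℂ) :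
    ContinuousAt (W.addG k) c := by
  have key : ∀ w ∈ W.lattice, ContinuousAt (W.addG k) w := by
    intro w hw
    have e : W.addG k = (W.addG k) ∘ fun z => z - w := by
      funext z
      have := W.addG_add k hw (z - w)
      simpa using this
    rw [e]
    have hc : ContinuousAt (fun z : ℂ => z - w) w := by fun_prop
    refine ContinuousAt.comp ?_ hc
    rw [sub_self]; exact W.addG_cont_zero hk
  by_cases h1 : c ∈ W.lattice
  · exact key c h1
  by_cases h2 : c - k ∈ W.lattice
  · have e : W.addG k = (W.addG k) ∘ fun z => k - z := by
      funext z; exact (W.addG_symm k z).symm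
    rw [e]
    have hc : ContinuousAt (fun z : ℂ => k - z) c := by fun_prop
    refine ContinuousAt.comp ?_ hc
    refine key _ ?_
    rw [← W.neg_mem_iff]; simpa using h2
  · exact (W.addG_diff k h1 h2).continuousAt

lemma addition (W : WeierstrassData) {k z : ℂ} (hk : k ∉ W.lattice) (hz : z ∉ W.lattice)
    (hzk : z - k ∉ W.lattice) :
    (W.Z (z - k) - W.Z z + W.Z k) ^ 2 = W.P z + W.P (z - k) + W.P k := by
  have hd : Differentiable ℂ (W.addG k) := fun c =>
    (analyticAt_of_differentiable_on_punctured_nhds_of_continuousAt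
      (W.addG_ev_diff k c) (W.addG_cont hk c)).differentiableAt
  have hb := (IsZLattice.isCompact_range_of_periodic W.pp.lattice _ hd.continuous
    (fun z w hw => W.addG_add k (W.mem_pp.1 hw) z)).isBounded
  have h := hd.apply_eq_apply_of_bounded hb z 0
  have g0 : W.addG k 0 = 0 := by simp [addG, W.zero_mem]
  rw [g0] at h
  simp only [addG, hz, hzk, or_self, if_false] at h
  linear_combination h

end WeierstrassData
namespace WeierstrassData

/-- Baker–Akhiezer solution. -/
def psi (W : WeierstrassData) (ω z0 k : ℂ) (x : ℝ) : ℂ :=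
  W.S (ω * x + z0 - k) / W.S (ω * x + z0) * exp (W.Z k * (ω * x))

/-- Its logarithmic derivative in `z`. -/
def rr (W : WeierstrassData) (ω z0 k : ℂ) (x : ℝ) : ℂ :=
  W.Z (ω * x + z0 - k) - W.Z (ω * x + z0) + W.Z k

lemma hasDerivAt_line (ω z0 : ℂ) (x : ℝ) : HasDerivAt (fun x : ℝ => ω * x + z0) ω x := by
  have h : HasDerivAt (fun x : ℝ => (x : ℂ)) 1 x := Complex.ofRealCLM.hasDerivAt
  simpa using (h.const_mul ω).add_const z0

lemma hasDerivAt_psi (W : WeierstrassData) {ω z0 k : ℂ} {x : ℝ}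
    (h1 : ω * x + z0 ∉ W.lattice) (h2 : ω * x + z0 - k ∉ W.lattice) :
    HasDerivAt (W.psi ω z0 k) (ω * W.rr ω z0 k x * W.psi ω z0 k x) x := by
  have a1 : HasDerivAt (fun x : ℝ => W.S (ω * x + z0 - k))
      (W.Z (ω * x + z0 - k) * W.S (ω * x + z0 - k) * ω) x :=
    (W.hasDerivAt_S h2).comp x ((hasDerivAt_line ω z0 x).sub_const k)
  have a2 : HasDerivAt (fun x : ℝ => W.S (ω * x + z0))
      (W.Z (ω * x + z0) * W.S (ω * x + z0) * ω) x :=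
    (W.hasDerivAt_S h1).comp x (hasDerivAt_line ω z0 x)
  have a3 : HasDerivAt (fun x : ℝ => exp (W.Z k * (ω * x)))
      (exp (W.Z k * (ω * x)) * (W.Z k * ω)) x := by
    have := (hasDerivAt_line ω 0 x).const_mul (W.Z k)
    simp only [add_zero] at this
    exact this.cexp
  have hS := W.S_ne _ h1
  refine ((a1.div a2 hS).mul a3).congr_deriv ?_
  simp only [psi, rr, Pi.div_apply]
  field_simp

lemma hasDerivAt_rr (W : WeierstrassData) {ω z0 k : ℂ} {x : ℝ}
    (h1 : ω * x + z0 ∉ W.lattice) (h2 : ω * x + z0 - k ∉ W.lattice) :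
    HasDerivAt (W.rr ω z0 k) (ω * (W.P (ω * x + z0) - W.P (ω * x + z0 - k))) x := by
  have a1 : HasDerivAt (fun x : ℝ => W.Z (ω * x + z0 - k))
      (-W.P (ω * x + z0 - k) * ω) x :=
    (W.hasDerivAt_Z h2).comp x ((hasDerivAt_line ω z0 x).sub_const k)
  have a2 : HasDerivAt (fun x : ℝ => W.Z (ω * x + z0))
      (-W.P (ω * x + z0) * ω) x :=
    (W.hasDerivAt_Z h1).comp x (hasDerivAt_line ω z0 x)
  refine ((a1.sub a2).add_const (W.Z k)).congr_deriv ?_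
  ring

lemma hasDerivAt_psi' (W : WeierstrassData) {ω z0 k : ℂ} {x : ℝ} (hk : k ∉ W.lattice)
    (h1 : ω * x + z0 ∉ W.lattice) (h2 : ω * x + z0 - k ∉ W.lattice) :
    HasDerivAt (fun x => ω * W.rr ω z0 k x * W.psi ω z0 k x)
      (ω ^ 2 * (2 * W.P (ω * x + z0) + W.P k) * W.psi ω z0 k x) x := by
  refine (((W.hasDerivAt_rr h1 h2).const_mul ω).mul (W.hasDerivAt_psi h1 h2)).congr_deriv ?_
  have := W.addition hk h1 h2
  have e : W.rr ω z0 k x ^ 2 = W.P (ω * x + z0) + W.P (ω * x + z0 - k) + W.P k := this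
  linear_combination ω ^ 2 * W.psi ω z0 k x * e

lemma psi_ne (W : WeierstrassData) {ω z0 k : ℂ} {x : ℝ}
    (h1 : ω * x + z0 ∉ W.lattice) (h2 : ω * x + z0 - k ∉ W.lattice) :
    W.psi ω z0 k x ≠ 0 :=
  mul_ne_zero (div_ne_zero (W.S_ne _ h2) (W.S_ne _ h1)) (exp_ne_zero _)

lemma line_two (ω z0 : ℂ) (x : ℝ) : ω * ((x + 2 : ℝ) : ℂ) + z0 = ω * x + z0 + 2 * ω := by
  push_cast; ring

lemma psi_add_two (W : WeierstrassData) {ω z0 k : ℂ} {x : ℝ}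
    (hω : 2 * ω ∈ W.lattice) (hω' : ω ∉ W.lattice)
    (h1 : ω * x + z0 ∉ W.lattice) (h2 : ω * x + z0 - k ∉ W.lattice) :
    W.psi ω z0 k (x + 2) = exp (-2 * (W.Z ω * k - ω * W.Z k)) * W.psi ω z0 k x := by
  obtain ⟨C, hC, hS⟩ := W.S_add_two hω hω'
  unfold psi
  rw [line_two, show ω * x + z0 + 2 * ω - k = ω * x + z0 - k + 2 * ω by ring, hS _ h1, hS _ h2]
  have e : exp (2 * W.Z ω * (ω * x + z0 - k)) * exp (W.Z k * (ω * ((x + 2 : ℝ) : ℂ)))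
      = exp (-2 * (W.Z ω * k - ω * W.Z k)) * exp (W.Z k * (ω * x))
        * exp (2 * W.Z ω * (ω * x + z0)) := by
    simp only [← Complex.exp_add]
    congr 1
    push_cast; ring
  have hSn := W.S_ne _ h1
  have he := exp_ne_zero (2 * W.Z ω * (ω * x + z0))
  generalize exp (2 * W.Z ω * (ω * x + z0 - k)) = E1 at *
  generalize exp (W.Z k * (ω * ((x + 2 : ℝ) : ℂ))) = E2 at *
  generalize exp (-2 * (W.Z ω * k - ω * W.Z k)) = E3 at *
  generalize exp (W.Z k * (ω * x)) = E4 at *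
  generalize exp (2 * W.Z ω * (ω * x + z0)) = E5 at *
  field_simp
  linear_combination W.S (ω * x + z0 - k) * e

lemma rr_add_two (W : WeierstrassData) {ω z0 k : ℂ} {x : ℝ}
    (hω : 2 * ω ∈ W.lattice) (hω' : ω ∉ W.lattice)
    (h1 : ω * x + z0 ∉ W.lattice) (h2 : ω * x + z0 - k ∉ W.lattice) :
    W.rr ω z0 k (x + 2) = W.rr ω z0 k x := by
  unfold rr
  rw [line_two, show ω * x + z0 + 2 * ω - k = ω * x + z0 - k + 2 * ω by ring,
    W.Z_add_two hω hω' h1, W.Z_add_two hω hω' h2]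
  ring

lemma contDiff_psi (W : WeierstrassData) {ω z0 k : ℂ}
    (h1 : ∀ x : ℝ, ω * x + z0 ∉ W.lattice) : ContDiff ℝ 2 (W.psi ω z0 k) := by
  have hS : ContDiff ℝ 2 W.S := (W.S_diff.contDiff (n := 2)).restrict_scalars ℝ
  have hx : ContDiff ℝ 2 (fun x : ℝ => (x : ℂ)) := Complex.ofRealCLM.contDiff
  have hl : ContDiff ℝ 2 (fun x : ℝ => ω * (x : ℂ) + z0) := (contDiff_const.mul hx).add contDiff_const
  unfold psi
  simp only [div_eq_mul_inv]
  refine ContDiff.mul (ContDiff.mul (hS.comp (hl.sub contDiff_const))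
    (ContDiff.inv (hS.comp hl) (fun x => W.S_ne _ (h1 x)))) ?_
  exact (contDiff_const.mul (contDiff_const.mul hx)).cexp

lemma bdd_of_periodic {f : ℝ → ℂ} (hf : Continuous f) (hp : ∀ x, f (x + 2) = f x) :
    ∃ C, ∀ x, ‖f x‖ ≤ C := by
  have hp' : Function.Periodic f 2 := hp
  have := (hp'.compact_of_continuous (by norm_num) hf).isBounded
  obtain ⟨C, hC⟩ := this.exists_norm_le
  exact ⟨C, fun x => hC _ ⟨x, rfl⟩⟩

lemma mem_spectrum (W : WeierstrassData) {ω z0 k : ℂ}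
    (hω : 2 * ω ∈ W.lattice) (hω' : ω ∉ W.lattice) (hk : k ∉ W.lattice)
    (h1 : ∀ x : ℝ, ω * x + z0 ∉ W.lattice) (h2 : ∀ x : ℝ, ω * x + z0 - k ∉ W.lattice)
    (hu : (W.Z ω * k - ω * W.Z k).re = 0) :
    -ω ^ 2 * W.P k ∈ W.lameSpectrum 1 ω z0 := by
  have hcd := W.contDiff_psi (k := k) h1
  refine ⟨W.psi ω z0 k, ?_, hcd, ?_, ?_⟩
  · intro h
    exact W.psi_ne (h1 0) (h2 0) (congrFun h 0)
  · intro x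
    have e : deriv (W.psi ω z0 k) = fun x => ω * W.rr ω z0 k x * W.psi ω z0 k x := by
      funext x; exact (W.hasDerivAt_psi (h1 x) (h2 x)).deriv
    rw [e, (W.hasDerivAt_psi' hk (h1 x) (h2 x)).deriv]
    push_cast
    ring
  · obtain ⟨C, hC⟩ := bdd_of_periodic (f := fun x => ((‖W.psi ω z0 k x‖ : ℝ) : ℂ))
      (by have := hcd.continuous; fun_prop) (fun x => by
        simp only [W.psi_add_two hω hω' (h1 x) (h2 x), norm_mul, Complex.norm_exp]
        have : (-2 * (W.Z ω * k - ω * W.Z k)).re = 0 := by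
          rw [show (-2 : ℂ) = ((-2 : ℝ) : ℂ) by push_cast; rfl, re_ofReal_mul, hu, mul_zero]
        rw [this]; simp)
    exact ⟨C, fun x => by simpa using hC x⟩

lemma deriv_bdd {φ : ℝ → ℂ} (hφ : ContDiff ℝ 2 φ) {C M : ℝ} (hC : ∀ x, ‖φ x‖ ≤ C)
    (hM : ∀ x, ‖deriv (deriv φ) x‖ ≤ M) (x : ℝ) : ‖deriv φ x‖ ≤ 2 * C + M := by
  have hd : Differentiable ℝ φ := hφ.differentiable (by norm_num)
  have hd' : Differentiable ℝ (deriv φ) := by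
    have : ContDiff ℝ 1 (deriv φ) := (contDiff_succ_iff_deriv.1 hφ).2.2
    exact this.differentiable (by norm_num)
  have hM0 : 0 ≤ M := (norm_nonneg _).trans (hM 0)
  have a1 : ∀ t ∈ Icc x (x + 1), ‖deriv φ t - deriv φ x‖ ≤ M := by
    intro t ht
    have := norm_image_sub_le_of_norm_deriv_le_segment' (f := deriv φ) (a := x) (b := x + 1) (C := M)
      (fun y _ => (hd' y).hasDerivAt.hasDerivWithinAt) (fun y _ => hM y) t ht
    refine this.trans ?_
    have : t - x ≤ 1 := by linarith [ht.2]
    nlinarith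
  have a2 := norm_image_sub_le_of_norm_deriv_le_segment' (f := fun t => φ t - (t : ℂ) * deriv φ x)
    (f' := fun t => deriv φ t - deriv φ x) (a := x) (b := x + 1) (C := M)
    (fun t _ => by
      have h : HasDerivAt (fun x : ℝ => (x : ℂ)) 1 t := Complex.ofRealCLM.hasDerivAt
      have := (hd t).hasDerivAt.sub (h.mul_const (deriv φ x))
      rw [one_mul] at this
      exact this.hasDerivWithinAt)
    (fun t ht => a1 t ⟨ht.1, ht.2.le⟩) (x + 1) ⟨by linarith, le_rfl⟩
  have e : deriv φ x = φ (x + 1) - φ x - (φ (x + 1) - ((x + 1 : ℝ) : ℂ) * deriv φ x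
      - (φ x - (x : ℂ) * deriv φ x)) := by push_cast; ring
  rw [e]
  refine (norm_sub_le _ _).trans ?_
  have b1 := norm_sub_le (φ (x + 1)) (φ x)
  have b2 := hC x
  have b3 := hC (x + 1)
  have : x + 1 - x = 1 := by ring
  rw [this, mul_one] at a2
  linarith

lemma psi_nat (W : WeierstrassData) {ω z0 k : ℂ}
    (hω : 2 * ω ∈ W.lattice) (hω' : ω ∉ W.lattice)
    (h1 : ∀ x : ℝ, ω * x + z0 ∉ W.lattice) (h2 : ∀ x : ℝ, ω * x + z0 - k ∉ W.lattice)
    (n : ℕ) (x : ℝ) :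
    W.psi ω z0 k (x + 2 * n) = exp (-2 * (W.Z ω * k - ω * W.Z k)) ^ n * W.psi ω z0 k x := by
  induction n with
  | zero => simp
  | succ n ih =>
    have : x + 2 * ((n + 1 : ℕ) : ℝ) = x + 2 * n + 2 := by push_cast; ring
    rw [this, W.psi_add_two hω hω' (h1 _) (h2 _), ih]
    ring

lemma log_deriv_eq (W : WeierstrassData) {ω z0 k : ℂ}
    (hω : 2 * ω ∈ W.lattice) (hω' : ω ∉ W.lattice) (hk : k ∉ W.lattice)
    (h1 : ∀ x : ℝ, ω * x + z0 ∉ W.lattice) (h2 : ∀ x : ℝ, ω * x + z0 - k ∉ W.lattice)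
    (hu : (W.Z ω * k - ω * W.Z k).re ≠ 0)
    {φ : ℝ → ℂ} (hφ : ContDiff ℝ 2 φ)
    (hode : ∀ x : ℝ, deriv (deriv φ) x = ω ^ 2 * (2 * W.P (ω * x + z0) + W.P k) * φ x)
    {C : ℝ} (hC : ∀ x, ‖φ x‖ ≤ C) (x : ℝ) : deriv φ x = ω * W.rr ω z0 k x * φ x := by
  have hd : Differentiable ℝ φ := hφ.differentiable (by norm_num)
  have hd' : Differentiable ℝ (deriv φ) := by
    have : ContDiff ℝ 1 (deriv φ) := (contDiff_succ_iff_deriv.1 hφ).2.2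
    exact this.differentiable (by norm_num)
  -- bounds
  obtain ⟨B, hB⟩ := bdd_of_periodic (f := fun x : ℝ => ω ^ 2 * (2 * W.P (ω * x + z0) + W.P k))
    (by
      rw [continuous_iff_continuousAt]
      intro x
      have : ContinuousAt (fun x : ℝ => W.P (ω * x + z0)) x :=
        ContinuousAt.comp (f := fun x : ℝ => ω * x + z0) (W.P_diff _ (h1 x)).continuousAt
          (hasDerivAt_line ω z0 x).continuousAt
      fun_prop)
    (fun x => by simp only [line_two, W.P_add hω])
  obtain ⟨D, hD⟩ := bdd_of_periodic (f := W.rr ω z0 k)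
    (by
      rw [continuous_iff_continuousAt]
      exact fun x => (W.hasDerivAt_rr (h1 x) (h2 x)).continuousAt)
    (fun x => W.rr_add_two hω hω' (h1 x) (h2 x))
  have hC0 : 0 ≤ C := (norm_nonneg _).trans (hC 0)
  have hM : ∀ x, ‖deriv (deriv φ) x‖ ≤ B * C := by
    intro x
    rw [hode, norm_mul]
    exact mul_le_mul (hB x) (hC x) (norm_nonneg _) ((norm_nonneg _).trans (hB x))
  have hφ' := deriv_bdd hφ hC hM
  -- Wronskian
  set d : ℝ → ℂ := fun x => deriv φ x - ω * W.rr ω z0 k x * φ x with hdd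
  have hdB : ∀ x, ‖d x‖ ≤ 2 * C + B * C + ‖ω‖ * D * C := by
    intro x
    refine (norm_sub_le _ _).trans (add_le_add (hφ' x) ?_)
    rw [norm_mul, norm_mul]
    have := hD x
    have := hC x
    have hD0 : 0 ≤ D := (norm_nonneg _).trans (hD 0)
    gcongr
  have hconst : ∀ x y, d x * W.psi ω z0 k x = d y * W.psi ω z0 k y := by
    have hder : ∀ x, HasDerivAt (fun x => d x * W.psi ω z0 k x) 0 x := by
      intro x
      have p1 := W.hasDerivAt_psi (h1 x) (h2 x)
      have p2 := W.hasDerivAt_psi' hk (h1 x) (h2 x)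
      have := ((hd' x).hasDerivAt.mul p1).sub ((hd x).hasDerivAt.mul p2)
      have e : (deriv φ * W.psi ω z0 k - φ * fun x => ω * W.rr ω z0 k x * W.psi ω z0 k x)
          = fun x => d x * W.psi ω z0 k x := by
        funext y
        simp only [hdd, Pi.sub_apply, Pi.mul_apply]
        ring
      rw [e] at this
      refine this.congr_deriv ?_
      rw [hode]
      ring
    exact is_const_of_deriv_eq_zero (fun x => (hder x).differentiableAt) (fun x => (hder x).deriv)
  set E := 2 * C + B * C + ‖ω‖ * D * C with hE
  set μ := exp (-2 * (W.Z ω * k - ω * W.Z k)) with hμ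
  have hμn : ‖μ‖ = Real.exp (-2 * (W.Z ω * k - ω * W.Z k).re) := by
    rw [hμ, Complex.norm_exp]
    congr 1
    rw [show (-2 : ℂ) = ((-2 : ℝ) : ℂ) by push_cast; rfl, re_ofReal_mul]
  have hμ0 : μ ≠ 0 := exp_ne_zero _
  have hzero : d 0 * W.psi ω z0 k 0 = 0 := by
    rw [← norm_eq_zero]
    refine le_antisymm ?_ (norm_nonneg _)
    rcases lt_or_gt_of_ne hu with hneg | hpos
    · have hlt : ‖μ‖⁻¹ < 1 := by
        rw [hμn, ← Real.exp_neg]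
        rw [Real.exp_lt_one_iff]; linarith
      have ht : Tendsto (fun n : ℕ => E * (‖μ‖⁻¹ ^ n * ‖W.psi ω z0 k 0‖)) atTop (𝓝 (E * (0 * ‖W.psi ω z0 k 0‖))) :=
        ((tendsto_pow_atTop_nhds_zero_of_lt_one (by positivity) hlt).mul_const _).const_mul E
      rw [zero_mul, mul_zero] at ht
      refine ge_of_tendsto' ht (fun n => ?_)
      rw [hconst 0 (-(2 * n)), norm_mul]
      have hp := W.psi_nat hω hω' h1 h2 n (-(2 * n))
      rw [neg_add_cancel, ← hμ] at hp
      have hp' : ‖W.psi ω z0 k (-(2 * n))‖ = ‖μ‖⁻¹ ^ n * ‖W.psi ω z0 k 0‖ := by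
        rw [hp, norm_mul, norm_pow, ← mul_assoc, ← mul_pow,
          inv_mul_cancel₀ (norm_ne_zero_iff.2 hμ0), one_pow, one_mul]
      rw [hp']
      have := hdB (-(2 * n))
      gcongr
    · have hlt : ‖μ‖ < 1 := by
        rw [hμn]
        rw [Real.exp_lt_one_iff]; linarith
      have ht : Tendsto (fun n : ℕ => E * (‖μ‖ ^ n * ‖W.psi ω z0 k 0‖)) atTop (𝓝 (E * (0 * ‖W.psi ω z0 k 0‖))) :=
        ((tendsto_pow_atTop_nhds_zero_of_lt_one (by positivity) hlt).mul_const _).const_mul E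
      rw [zero_mul, mul_zero] at ht
      refine ge_of_tendsto' ht (fun n => ?_)
      rw [hconst 0 (0 + 2 * n), norm_mul, W.psi_nat hω hω' h1 h2 n 0, norm_mul, norm_pow]
      have := hdB (0 + 2 * n)
      gcongr
  have := hconst x 0
  rw [hzero] at this
  have := (mul_eq_zero.1 this).resolve_right (W.psi_ne (h1 x) (h2 x))
  exact sub_eq_zero.1 this

lemma re_eq_zero (W : WeierstrassData) {ω z0 k : ℂ}
    (hω : 2 * ω ∈ W.lattice) (hω' : ω ∉ W.lattice) (hk : k ∉ W.lattice)
    (h1 : ∀ x : ℝ, ω * x + z0 ∉ W.lattice) (h2 : ∀ x : ℝ, ω * x + z0 - k ∉ W.lattice)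
    (h3 : ∀ x : ℝ, ω * x + z0 + k ∉ W.lattice)
    (h4 : ∀ x : ℝ, W.Z (ω * x + z0 - k) - W.Z (ω * x + z0 + k) + 2 * W.Z k ≠ 0)
    (hs : -ω ^ 2 * W.P k ∈ W.lameSpectrum 1 ω z0) :
    (W.Z ω * k - ω * W.Z k).re = 0 := by
  by_contra hu
  obtain ⟨φ, hφ0, hφ, hode, C, hC⟩ := hs
  have hode' : ∀ x : ℝ, deriv (deriv φ) x = ω ^ 2 * (2 * W.P (ω * x + z0) + W.P k) * φ x := by
    intro x
    have := hode x
    push_cast at this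
    linear_combination -this
  have hω0 : ω ≠ 0 := by rintro rfl; exact hω' W.zero_mem
  have hu' : (W.Z ω * (-k) - ω * W.Z (-k)).re ≠ 0 := by
    rw [W.Z_odd, show W.Z ω * (-k) - ω * -W.Z k = -(W.Z ω * k - ω * W.Z k) by ring, neg_re]
    exact neg_ne_zero.2 hu
  have e1 := W.log_deriv_eq hω hω' hk h1 h2 hu hφ hode' hC
  have e2 := W.log_deriv_eq (k := -k) hω hω' (by rwa [W.neg_mem_iff]) h1
    (by simpa using h3) hu' hφ (by rw [W.P_even hk]; exact hode') hC
  apply hφ0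
  funext x
  have e3 := (e1 x).symm.trans (e2 x)
  simp only [rr, sub_neg_eq_add, W.Z_odd] at e3
  have : ω * (W.Z (ω * x + z0 - k) - W.Z (ω * x + z0 + k) + 2 * W.Z k) * φ x = 0 := by
    linear_combination e3
  exact (mul_eq_zero.1 this).resolve_left (mul_ne_zero hω0 (h4 x))

end WeierstrassData
namespace WeierstrassData

lemma exists_rep (W : WeierstrassData) {ω : ℂ} (hω : 2 * ω ∈ W.lattice) (z0 : ℂ) (x : ℝ) :
    ∃ y ∈ Icc (0 : ℝ) 2, ∃ w ∈ W.lattice, ω * x + z0 = ω * y + z0 + w := by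
  refine ⟨x - 2 * ⌊x / 2⌋, ⟨?_, ?_⟩, (⌊x / 2⌋ : ℤ) • (2 * ω), ?_, ?_⟩
  · have := Int.floor_le (x / 2); linarith
  · have := Int.lt_floor_add_one (x / 2); linarith
  · rw [← mem_pp] at *
    exact Submodule.smul_mem _ _ hω
  · rw [zsmul_eq_mul]; push_cast; ring

lemma eventually_good (W : WeierstrassData) {ω z0 : ℂ} (hω : 2 * ω ∈ W.lattice)
    (h1 : ∀ x : ℝ, ω * x + z0 ∉ W.lattice) :
    ∀ᶠ k in 𝓝[≠] (0 : ℂ), k ∉ W.lattice ∧ (∀ x : ℝ, ω * x + z0 - k ∉ W.lattice) ∧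
      (∀ x : ℝ, ω * x + z0 + k ∉ W.lattice) ∧
      (∀ x : ℝ, W.Z (ω * x + z0 - k) - W.Z (ω * x + z0 + k) + 2 * W.Z k ≠ 0) := by
  have hlc : Continuous (fun x : ℝ => ω * x + z0) := by fun_prop
  set T : Set ℂ := (fun x : ℝ => ω * x + z0) '' Icc (0 : ℝ) 2 with hT
  have hTc : IsCompact T := isCompact_Icc.image hlc
  have hTs : T ⊆ W.latticeᶜ := by
    rintro _ ⟨x, -, rfl⟩; exact h1 x
  obtain ⟨δ, hδ, hsub⟩ := hTc.exists_cthickening_subset_open W.isOpen_compl hTs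
  have hcont : ContinuousOn W.Z (Metric.cthickening δ T) := fun z hz =>
    (W.Z_diff z (hsub hz)).continuousAt.continuousWithinAt
  obtain ⟨M, hM⟩ := hTc.cthickening.exists_bound_of_continuousOn hcont
  have hin : ∀ y ∈ Icc (0 : ℝ) 2, ∀ k : ℂ, ‖k‖ ≤ δ →
      ω * y + z0 + k ∈ Metric.cthickening δ T := by
    intro y hy k hk
    refine Metric.mem_cthickening_of_dist_le _ (ω * y + z0) _ _ ⟨y, hy, rfl⟩ ?_
    simpa [dist_eq_norm] using hk
  have hnot : ∀ k : ℂ, ‖k‖ ≤ δ → ∀ x : ℝ, ω * x + z0 + k ∉ W.lattice := by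
    intro k hk x
    obtain ⟨y, hy, w, hw, e⟩ := W.exists_rep hω z0 x
    rw [e, show ω * y + z0 + w + k = ω * y + z0 + k + w by ring, W.add_mem_iff hw]
    exact hsub (hin y hy k hk)
  have hbd : ∀ k : ℂ, ‖k‖ ≤ δ → ∀ x : ℝ,
      ‖W.Z (ω * x + z0 - k) - W.Z (ω * x + z0 + k)‖ ≤ 2 * M := by
    intro k hk x
    obtain ⟨y, hy, w, hw, e⟩ := W.exists_rep hω z0 x
    obtain ⟨c, hc⟩ := W.Z_add hw
    have i1 := hin y hy k hk
    have i2 := hin y hy (-k) (by simpa using hk)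
    rw [e, show ω * y + z0 + w + k = ω * y + z0 + k + w by ring,
      show ω * y + z0 + w - k = ω * y + z0 + -k + w by ring, hc _ (hsub i1), hc _ (hsub i2),
      add_sub_add_right_eq_sub]
    refine (norm_sub_le _ _).trans ?_
    have := hM _ i1
    have := hM _ i2
    linarith
  obtain ⟨h, hha, h0, -, -, hZ, -⟩ := W.exists_h
  have hh1 : ∀ᶠ k in 𝓝[≠] (0 : ℂ), ‖h k‖ < 1 := by
    have : Tendsto (fun k => ‖h k‖) (𝓝 0) (𝓝 ‖h 0‖) := hha.continuousAt.norm.tendsto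
    rw [h0, norm_zero] at this
    exact (this.eventually_lt_const one_pos).filter_mono nhdsWithin_le_nhds
  have hinv : ∀ᶠ k in 𝓝[≠] (0 : ℂ), M + 1 < ‖k⁻¹‖ :=
    (tendsto_norm_inv_nhdsNE_zero_atTop (α := ℂ)).eventually_gt_atTop (M + 1)
  have hsm : ∀ᶠ k in 𝓝[≠] (0 : ℂ), ‖k‖ ≤ δ := by
    have : ∀ᶠ k in 𝓝 (0 : ℂ), k ∈ Metric.closedBall (0 : ℂ) δ := Metric.closedBall_mem_nhds _ hδ
    refine (this.mono ?_).filter_mono nhdsWithin_le_nhds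
    intro k hk
    simpa using hk
  filter_upwards [hh1, hinv, hsm, hZ, W.eventually_notMem 0] with k a1 a2 a3 a4 a5
  refine ⟨a5, fun x => by simpa [sub_eq_add_neg] using hnot (-k) (by simpa using a3) x,
    hnot k a3, fun x hx => ?_⟩
  have b1 := hbd k a3 x
  have b2 : W.Z (ω * x + z0 - k) - W.Z (ω * x + z0 + k) = -(2 * W.Z k) := by
    linear_combination hx
  rw [b2, norm_neg, norm_mul, a4, one_div] at b1
  have b3 : ‖k⁻¹‖ ≤ ‖k⁻¹ + h k‖ + ‖h k‖ := by
    have := norm_sub_le (k⁻¹ + h k) (h k)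
    simpa using this
  simp only [Complex.norm_ofNat] at b1
  linarith

lemma spec_iff (W : WeierstrassData) {ω z0 : ℂ} (hω : 2 * ω ∈ W.lattice) (hω' : ω ∉ W.lattice)
    (h1 : ∀ x : ℝ, ω * x + z0 ∉ W.lattice) :
    ∀ᶠ k in 𝓝[≠] (0 : ℂ), (-ω ^ 2 * W.P k ∈ W.lameSpectrum 1 ω z0 ↔
      (W.Z ω * k - ω * W.Z k).re = 0) := by
  filter_upwards [W.eventually_good hω h1] with k hk
  obtain ⟨a, b, c, d⟩ := hk
  exact ⟨W.re_eq_zero hω hω' a h1 b c d, W.mem_spectrum hω hω' a h1 b⟩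

lemma isBigO_sq {g : ℂ → ℂ} (hg : AnalyticAt ℂ g 0) (g0 : g 0 = 0) (g1 : deriv g 0 = 0) :
    g =O[𝓝 0] fun z => z ^ 2 := by
  obtain ⟨p, hp⟩ := hg
  have hd : DifferentiableAt ℂ (dslope g 0) 0 :=
    hp.has_fpower_series_dslope_fslope.analyticAt.differentiableAt
  have h1 := hd.isBigO_sub
  simp only [dslope_same, g1, sub_zero] at h1
  have h2 := (Asymptotics.isBigO_refl (fun z : ℂ => z) (𝓝 0)).mul h1
  refine (h2.congr ?_ ?_)
  · intro z
    have := sub_smul_dslope g 0 z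
    simpa [g0] using this
  · intro z; ring

lemma isBigO_cube {g : ℂ → ℂ} (hg : AnalyticAt ℂ g 0) (g0 : g 0 = 0)
    (g1 : deriv g =O[𝓝 0] fun z => z ^ 2) : g =O[𝓝 0] fun z => z ^ 3 := by
  obtain ⟨C, hC⟩ := g1.bound
  have hC' : ∀ᶠ z in 𝓝 (0 : ℂ), ‖deriv g z‖ ≤ |C| * ‖z‖ ^ 2 := by
    filter_upwards [hC] with z hz
    rw [norm_pow] at hz
    refine hz.trans ?_
    have := le_abs_self C
    gcongr
  obtain ⟨r, hr, hball⟩ := Metric.eventually_nhds_iff_ball.1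
    (hC'.and hg.eventually_analyticAt)
  refine Asymptotics.IsBigO.of_bound |C| ?_
  filter_upwards [Metric.ball_mem_nhds (0 : ℂ) hr] with z hz
  have hz' : ‖z‖ < r := by simpa using hz
  have hs : ∀ y ∈ Metric.closedBall (0 : ℂ) ‖z‖, y ∈ Metric.ball (0 : ℂ) r := by
    intro y hy
    have : ‖y‖ ≤ ‖z‖ := by simpa using hy
    simpa using this.trans_lt hz'
  have := (convex_closedBall (0 : ℂ) ‖z‖).norm_image_sub_le_of_norm_deriv_le (f := g)
    (C := |C| * ‖z‖ ^ 2) (x := 0) (y := z)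
    (fun y hy => (hball y (hs y hy)).2.differentiableAt)
    (fun y hy => ((hball y (hs y hy)).1).trans (by
      have : ‖y‖ ≤ ‖z‖ := by simpa using hy
      gcongr)) (by simp) (by simp)
  rw [g0, sub_zero, sub_zero] at this
  rw [norm_pow]
  calc _ ≤ _ := this
    _ = _ := by ring

end WeierstrassData

/-- For `m = 1`, the spectral arc of the complex Lamé operator
`L = -d²/dx² + 2ω²℘(ωx+z₀)` extending to infinity is asymptotic to the positive
real half-line shifted by `-2ηω`: it admits a parameterisation `Λ(s)` near
infinity (covering all spectral points of large modulus) with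
`Λ(s) = 1/s² - 2ηω + O(s²)` as `s → 0`. -/
theorem infinite_spectral_arc_asymptotics
    (W : WeierstrassData) (ω : ℂ) (hω : 2 * ω ∈ W.lattice) (hω' : ω ∉ W.lattice)
    (z0 : ℂ) (hz0 : ∀ x : ℝ, ω * x + z0 ∉ W.lattice) :
    ∃ Λ : ℝ → ℂ, ∃ ε : ℝ, 0 < ε ∧
      (∀ s : ℝ, 0 < |s| → |s| < ε → Λ s ∈ W.lameSpectrum 1 ω z0) ∧
      (∃ R : ℝ, ∀ μ ∈ W.lameSpectrum 1 ω z0, R < ‖μ‖ →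
        ∃ s : ℝ, 0 < |s| ∧ |s| < ε ∧ Λ s = μ) ∧
      (fun s : ℝ => Λ s - (1 / (s : ℂ) ^ 2 - 2 * W.Z ω * ω))
        =O[nhdsWithin 0 {(0 : ℝ)}ᶜ] fun s : ℝ => s ^ 2 := by
  classical
  obtain ⟨h, hha, h0, hd0, hdd0, hZ, hP⟩ := W.exists_h
  have hω0 : ω ≠ 0 := by rintro rfl; exact hω' W.zero_mem
  set η := W.Z ω with hη
  set D : ℂ → ℂ := fun k => 1 - (η / ω) * k ^ 2 + k * h k with hD
  set F : ℂ → ℂ := fun k => k / D k with hF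
  have hDa : AnalyticAt ℂ D 0 := by
    have : AnalyticAt ℂ (fun k : ℂ => k) 0 := analyticAt_id
    exact (analyticAt_const.sub (analyticAt_const.mul (this.pow 2))).add (this.mul hha)
  have hD0 : D 0 = 1 := by simp [hD]
  have hF0 : F 0 = 0 := by simp [hF]
  have hFa : AnalyticAt ℂ F 0 := analyticAt_id.div hDa (by simp [hD0])
  have hFd : HasStrictDerivAt F 1 0 := by
    have e1 := (hasDerivAt_id (0 : ℂ)).div hDa.differentiableAt.hasDerivAt (by simp [hD0])
    have e2 : deriv F 0 = 1 := by
      have := e1.deriv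
      simp only [id_eq, hD0] at this
      have e3 : (id / D) = F := rfl
      rw [e3] at this
      rw [this]; simp
    rw [← e2]; exact hFa.hasStrictDerivAt
  set K := hFd.localInverse F 1 0 one_ne_zero with hK
  have hKl : ∀ᶠ k in 𝓝 (0 : ℂ), K (F k) = k := hFd.eventually_left_inverse one_ne_zero
  have hKr : ∀ᶠ z in 𝓝 (0 : ℂ), F (K z) = z := by
    have := hFd.eventually_right_inverse one_ne_zero
    rwa [hF0] at this
  have hKd : HasStrictDerivAt K 1 0 := by
    have := hFd.to_localInverse one_ne_zero
    rw [hF0, inv_one] at this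
    exact this
  have hK0 : K 0 = 0 := by
    have := hKl.self_of_nhds
    rwa [hF0] at this
  have hDne : ∀ᶠ k in 𝓝[≠] (0 : ℂ), D k ≠ 0 :=
    (hDa.continuousAt.eventually_ne (by simp [hD0])).filter_mono nhdsWithin_le_nhds
  -- the collected good properties of small `k`
  have hgood : ∀ᶠ k in 𝓝[≠] (0 : ℂ), (-ω ^ 2 * W.P k ∈ W.lameSpectrum 1 ω z0 ↔
      (-ω / F k).re = 0) ∧ F k ≠ 0 ∧ K (F k) = k ∧ W.P k = 1 / k ^ 2 - deriv h k ∧ D k ≠ 0 := by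
    filter_upwards [W.spec_iff hω hω' hz0, hZ, hP, hDne, hKl.filter_mono nhdsWithin_le_nhds,
      self_mem_nhdsWithin] with k a1 a2 a3 a4 a5 a6
    have a6 : k ≠ 0 := a6
    refine ⟨?_, div_ne_zero a6 a4, a5, a3, a4⟩
    rw [a1]
    have : W.Z ω * k - ω * W.Z k = -ω / F k := by
      rw [a2, ← hη]
      simp only [hF]
      rw [div_div_eq_mul_div, eq_div_iff a6]
      simp only [hD]
      field_simp
      ring
    rw [this]
  -- the curve
  set c : ℝ → ℂ := fun s => K (I * ω * s) with hc
  have hline : Tendsto (fun s : ℝ => I * ω * (s : ℂ)) (𝓝[≠] 0) (𝓝 0) := by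
    have : Continuous (fun s : ℝ => I * ω * (s : ℂ)) := by fun_prop
    have := this.tendsto 0
    simp only [ofReal_zero, mul_zero] at this
    exact this.mono_left nhdsWithin_le_nhds
  have hFc : ∀ᶠ s in 𝓝[≠] (0 : ℝ), F (c s) = I * ω * s := hline.eventually hKr
  have hct : Tendsto c (𝓝[≠] 0) (𝓝[≠] 0) := by
    refine tendsto_nhdsWithin_iff.2 ⟨?_, ?_⟩
    · have := hKd.hasDerivAt.continuousAt.tendsto
      rw [hK0] at this
      exact this.comp hline
    · filter_upwards [hFc, self_mem_nhdsWithin] with s hs hs0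
      have hs0 : s ≠ 0 := hs0
      intro h
      have h : c s = 0 := h
      rw [h, hF0] at hs
      have : (s : ℂ) ≠ 0 := by exact_mod_cast hs0
      exact mul_ne_zero (mul_ne_zero I_ne_zero hω0) this hs.symm
  have hcgood := hct.eventually hgood
  obtain ⟨ε, hε, hεs⟩ := Metric.mem_nhdsWithin_iff.1 (hFc.and hcgood)
  refine ⟨fun s => -ω ^ 2 * W.P (c s), ε, hε, ?_, ?_, ?_⟩
  · intro s hs0 hs
    obtain ⟨b1, b2, -⟩ := hεs ⟨by simpa using hs, by simpa using hs0⟩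
    have hs0' : (s : ℂ) ≠ 0 := by exact_mod_cast abs_pos.1 hs0
    rw [b2, b1]
    have : -ω / (I * ω * s) = I * ((1 / s : ℝ) : ℂ) := by
      push_cast
      field_simp
      rw [I_sq]
    rw [this]
    simp
  · -- covering
    set E : ℂ → ℂ := fun k => 1 - k ^ 2 * deriv h k with hE
    set Q : ℂ → ℂ := fun k => k ^ 2 / E k with hQ
    have hid : AnalyticAt ℂ (fun k : ℂ => k) 0 := analyticAt_id
    have hEa : AnalyticAt ℂ E 0 := analyticAt_const.sub ((hid.pow 2).mul hha.deriv)
    have hE0 : E 0 = 1 := by simp [hE]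
    have hQa : AnalyticAt ℂ Q 0 := (hid.pow 2).div hEa (by simp [hE0])
    have hQ0 : Q 0 = 0 := by simp [hQ]
    have hopen : 𝓝 (0 : ℂ) ≤ map Q (𝓝 0) := by
      have := hQa.eventually_constant_or_nhds_le_map_nhds
      rw [hQ0] at this
      refine this.resolve_left ?_
      intro hcon
      have h2 : ∀ᶠ k in 𝓝[≠] (0 : ℂ), False := by
        filter_upwards [hcon.filter_mono nhdsWithin_le_nhds, self_mem_nhdsWithin,
          (hEa.continuousAt.eventually_ne (by simp [hE0] : E 0 ≠ 0)).filter_mono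
            nhdsWithin_le_nhds] with k a1 a2 a3
        exact div_ne_zero (pow_ne_zero 2 a2) a3 a1
      simpa using h2.exists
    have hsm : ∀ᶠ k in 𝓝[≠] (0 : ℂ), ‖F k‖ < ‖ω‖ * ε := by
      have : Tendsto (fun k => ‖F k‖) (𝓝 0) (𝓝 ‖F 0‖) := hFa.continuousAt.norm.tendsto
      rw [hF0, norm_zero] at this
      have hpos : 0 < ‖ω‖ * ε := mul_pos (norm_pos_iff.2 hω0) hε
      exact (this.eventually_lt_const hpos).filter_mono nhdsWithin_le_nhds
    have hall := eventually_nhdsWithin_iff.1 (hgood.and hsm)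
    have himg := hopen (image_mem_map hall)
    obtain ⟨δ, hδ, hδs⟩ := Metric.mem_nhds_iff.1 himg
    refine ⟨‖ω‖ ^ 2 / δ, fun μ hμ hR => ?_⟩
    have hR0 : 0 ≤ ‖ω‖ ^ 2 / δ := by positivity
    have hμpos : 0 < ‖μ‖ := hR0.trans_lt hR
    have hμ0 : μ ≠ 0 := norm_pos_iff.1 hμpos
    have hy0 : -ω ^ 2 / μ ≠ 0 := div_ne_zero (neg_ne_zero.2 (pow_ne_zero 2 hω0)) hμ0
    have hy : -ω ^ 2 / μ ∈ Metric.ball (0 : ℂ) δ := by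
      rw [mem_ball_zero_iff, norm_div, norm_neg, norm_pow, div_lt_iff₀ hμpos]
      rw [div_lt_iff₀ hδ] at hR
      linarith
    obtain ⟨k, hk, hQk⟩ := hδs hy
    have hk0 : k ≠ 0 := by
      rintro rfl
      rw [hQ0] at hQk
      exact hy0 hQk.symm
    obtain ⟨⟨b1, b2, b3, b4, b5⟩, b6⟩ := hk hk0
    have hEk : E k ≠ 0 := by
      intro hEk
      simp only [hQ, hEk, div_zero] at hQk
      exact hy0 hQk.symm
    have hPk : -ω ^ 2 * W.P k = μ := by
      have e1 : W.P k = 1 / Q k := by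
        rw [b4]
        simp only [hQ, one_div_div]
        simp only [hE]
        field_simp
      rw [e1, hQk]
      field_simp
    rw [hPk] at b1
    have hre := b1.1 hμ
    set t := (-ω / F k).im with ht
    have hft : -ω / F k = I * t := by
      apply Complex.ext
      · rw [hre]; simp
      · simp [ht]
    have ht0 : t ≠ 0 := by
      intro h
      rw [h] at hft
      simp only [ofReal_zero, mul_zero] at hft
      exact div_ne_zero (neg_ne_zero.2 hω0) b2 hft
    have htc : (t : ℂ) ≠ 0 := by exact_mod_cast ht0
    have hFk : F k = I * ω * ((1 / t : ℝ) : ℂ) := by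
      have : -ω = I * t * F k := by
        rw [← hft, div_mul_cancel₀ _ b2]
      push_cast
      field_simp
      linear_combination I * this + F k * t * I_sq
    refine ⟨1 / t, by positivity, ?_, ?_⟩
    · rw [hFk, norm_mul, norm_mul, norm_I, one_mul, norm_real, Real.norm_eq_abs] at b6
      exact lt_of_mul_lt_mul_left b6 (norm_nonneg _)
    · have : c (1 / t) = k := by
        simp only [hc]
        rw [← hFk, b3]
      change -ω ^ 2 * W.P (c (1 / t)) = μ
      rw [this, hPk]
  · -- asymptotics
    have o1 : deriv h =O[𝓝 0] fun z => z ^ 2 := WeierstrassData.isBigO_sq hha.deriv hd0 hdd0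
    have o2 : h =O[𝓝 0] fun z => z ^ 3 := WeierstrassData.isBigO_cube hha h0 o1
    have o3 : (fun k => h k / k) =O[𝓝[≠] 0] fun z : ℂ => z ^ 2 := by
      have := (o2.mono (nhdsWithin_le_nhds (s := {(0 : ℂ)}ᶜ))).mul
        (Asymptotics.isBigO_refl (fun z : ℂ => z⁻¹) (𝓝[≠] 0))
      refine this.congr' (by filter_upwards with k; rw [div_eq_mul_inv]) ?_
      filter_upwards [self_mem_nhdsWithin] with k hk
      have hk : k ≠ 0 := hk
      field_simp
    have o4 : (fun k => h k - η * k / ω) =O[𝓝 0] fun z : ℂ => z := by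
      have hda : DifferentiableAt ℂ (fun k => h k - η * k / ω) 0 := by
        have := hha.differentiableAt
        fun_prop
      simpa [h0] using hda.isBigO_sub
    have o5 : (fun k => -ω ^ 2 * (-deriv h k - 2 * (h k / k) - (h k - η * k / ω) ^ 2))
        =O[𝓝[≠] 0] fun z : ℂ => z ^ 2 := by
      refine Asymptotics.IsBigO.const_mul_left ?_ _
      refine ((o1.mono nhdsWithin_le_nhds).neg_left.sub (o3.const_mul_left 2)).sub ?_
      exact (o4.mono nhdsWithin_le_nhds).pow 2
    have o6 : c =O[𝓝[≠] 0] fun s : ℝ => s := by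
      have h1 : K =O[𝓝 0] fun z : ℂ => z := by
        simpa [hK0] using hKd.hasDerivAt.differentiableAt.isBigO_sub
      have h2 := h1.comp_tendsto hline
      refine h2.trans (Asymptotics.IsBigO.of_bound ‖ω‖ ?_)
      filter_upwards with s
      simp
    have o7 := (o5.comp_tendsto hct).trans (o6.pow 2)
    refine o7.congr' ?_ (by rfl)
    filter_upwards [hFc, hcgood, hct.eventually self_mem_nhdsWithin, self_mem_nhdsWithin]
      with s b1 b2 b3 b4
    obtain ⟨-, b5, -, b6, b7⟩ := b2
    have b3 : c s ≠ 0 := b3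
    have b4 : s ≠ 0 := b4
    have hs0 : (s : ℂ) ≠ 0 := by exact_mod_cast b4
    have e1 : 1 / (s : ℂ) ^ 2 = -ω ^ 2 * (D (c s) / c s) ^ 2 := by
      have : D (c s) / c s = 1 / (I * ω * s) := by
        rw [← b1]; simp only [hF]; rw [one_div_div]
      rw [this, div_pow, mul_pow, mul_pow, I_sq]
      field_simp
    simp only [Function.comp]
    rw [b6, e1]
    simp only [hD]
    field_simp
    ring
end
end

section
/- Fix e₂ = i and e₃ = −i and for real t let Φ(t) = ∮_γ √((E−t)/(4(E²+1))) dE, the contour integral over a fixed closed contour γ in the complex E-plane encircling the points i and −i (equivalently, encircling t and ∞). Then Φ'(t) = −(1/2)∮_γ dE/√(4(E²+1)(E−t)) < 0 for all real t, so Φ is strictly monotonically decreasing on ℝ; moreover Φ(−2) > 0 and Φ(2) < 0, hence Φ has exactly one real zero t = t*. -/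
open Complex Set Filter intervalIntegral

noncomputable section

/-- The winding number of a (`C¹`, `1`-periodic) loop `γ` around a point `a`:
`(2πi)⁻¹ ∮ γ'(s)/(γ(s) - a) ds`. -/
def windingNumber (γ : ℝ → ℂ) (a : ℂ) : ℂ :=
  (2 * Real.pi * Complex.I)⁻¹ * ∫ s in (0:ℝ)..1, deriv γ s / (γ s - a)

/-- A reference loop encircling `i` and `-i` once (counterclockwise) and
leaving `t = 2` outside: the ellipse `s ↦ -sin(2πs)/2 + 2i·cos(2πs)`,
starting (and based) at `2i`. -/
def baseLoop : ℝ → ℂ :=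
  fun s => ((-(1 / 2) * Real.sin (2 * Real.pi * s) : ℝ) : ℂ)
    + ((2 * Real.cos (2 * Real.pi * s) : ℝ) : ℂ) * Complex.I

open Topology Metric

def csq (z : ℂ) : ℂ := Complex.exp (Complex.log z / 2)

lemma csq_ne (z : ℂ) : csq z ≠ 0 := Complex.exp_ne_zero _

lemma csq_sq {z : ℂ} (hz : z ≠ 0) : csq z ^ 2 = z := by
  unfold csq
  rw [← Complex.exp_nat_mul]
  push_cast
  rw [mul_div_cancel₀ _ (two_ne_zero), Complex.exp_log hz]

lemma csq_one : csq 1 = 1 := by simp [csq]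

lemma csq_hasDerivAt {z : ℂ} (hz : z ∈ slitPlane) : HasDerivAt csq (csq z / (2 * z)) z := by
  have h := ((Complex.hasDerivAt_log hz).div_const 2).cexp
  refine h.congr_deriv ?_
  unfold csq
  have := Complex.slitPlane_ne_zero hz
  field_simp

lemma csq_continuousAt {z : ℂ} (hz : z ∈ slitPlane) : ContinuousAt csq z :=
  (csq_hasDerivAt hz).continuousAt

lemma ratio_mem {w w0 : ℂ} (h : ‖w - w0‖ < ‖w0‖) : w / w0 ∈ slitPlane := by
  have h0 : 0 < ‖w0‖ := lt_of_le_of_lt (norm_nonneg _) h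
  have h0' : w0 ≠ 0 := norm_pos_iff.mp h0
  have : w / w0 = 1 + (w - w0) / w0 := by field_simp; ring
  rw [this]
  apply Complex.mem_slitPlane_of_norm_lt_one
  rw [norm_div, div_lt_one h0]
  exact h

lemma num_ne_of_ratio {w w0 : ℂ} (h : ‖w - w0‖ < ‖w0‖) : w ≠ 0 := by
  rintro rfl
  simp at h

/-- two uniformly close loops, with coherent local branches, have the same integral -/
lemma close_loops (γ₀ γ₁ : ℝ → ℂ) (h0 : ContDiff ℝ 1 γ₀) (h1 : ContDiff ℝ 1 γ₁)
    (p0 : Function.Periodic γ₀ 1) (p1 : Function.Periodic γ₁ 1) (r : ℝ) (hr : 0 < r)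
    (hclose : ∀ s, γ₁ s ∈ ball (γ₀ s) r) (f : ℝ → ℂ → ℂ)
    (hf : ∀ s, DifferentiableOn ℂ (f s) (ball (γ₀ s) r))
    (hcoh : ∀ s, ∀ᶠ s' in 𝓝 s, ∀ z ∈ ball (γ₀ s) r, f s' z = f s z)
    (hper : f 1 = f 0) (hc0 : Continuous fun s => f s (γ₀ s))
    (hc1 : Continuous fun s => f s (γ₁ s)) :
    ∫ s in (0:ℝ)..1, f s (γ₁ s) * deriv γ₁ s = ∫ s in (0:ℝ)..1, f s (γ₀ s) * deriv γ₀ s := by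
  have hF : ∀ s, ∃ F : ℂ → ℂ, ∀ z ∈ ball (γ₀ s) r, HasDerivAt F (f s z) z := fun s =>
    (hf s).isExactOn_ball
  choose F hF using hF
  -- constancy of differences of primitives
  have key : ∀ s s', (∀ z ∈ ball (γ₀ s) r, f s' z = f s z) →
      ∀ a ∈ ball (γ₀ s) r ∩ ball (γ₀ s') r, ∀ b ∈ ball (γ₀ s) r ∩ ball (γ₀ s') r,
      F s' b - F s' a = F s b - F s a := by
    intro s s' hss a ha b hb
    have hconv : Convex ℝ (ball (γ₀ s) r ∩ ball (γ₀ s') r) :=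
      (convex_ball _ _).inter (convex_ball _ _)
    have hop : IsOpen (ball (γ₀ s) r ∩ ball (γ₀ s') r) := isOpen_ball.inter isOpen_ball
    have hd : ∀ z ∈ ball (γ₀ s) r ∩ ball (γ₀ s') r,
        HasDerivAt (fun z => F s' z - F s z) 0 z := by
      intro z hz
      have := (hF s' z hz.2).sub (hF s z hz.1)
      rw [hss z hz.1, sub_self] at this
      exact this
    have := hop.is_const_of_deriv_eq_zero hconv.isPreconnected
      (fun z hz => (hd z hz).differentiableAt.differentiableWithinAt)
      (fun z hz => (hd z hz).deriv) ha hb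
    linear_combination -this
  let P : ℝ → ℂ := fun s => F s (γ₁ s) - F s (γ₀ s)
  have hP : ∀ s, HasDerivAt P (f s (γ₁ s) * deriv γ₁ s - f s (γ₀ s) * deriv γ₀ s) s := by
    intro s
    have d1 : HasDerivAt γ₁ (deriv γ₁ s) s := (h1.differentiable one_ne_zero s).hasDerivAt
    have d0 : HasDerivAt γ₀ (deriv γ₀ s) s := (h0.differentiable one_ne_zero s).hasDerivAt
    have e1 := (hF s (γ₁ s) (hclose s)).comp s d1
    have e0 := (hF s (γ₀ s) (mem_ball_self hr)).comp s d0
    refine (e1.sub e0).congr_of_eventuallyEq ?_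
    have m1 : ∀ᶠ s' in 𝓝 s, γ₁ s' ∈ ball (γ₀ s) r :=
      h1.continuous.continuousAt.eventually (isOpen_ball.mem_nhds (hclose s))
    have m0 : ∀ᶠ s' in 𝓝 s, γ₀ s' ∈ ball (γ₀ s) r :=
      h0.continuous.continuousAt.eventually (isOpen_ball.mem_nhds (mem_ball_self hr))
    filter_upwards [hcoh s, m1, m0] with s' a b c
    exact key s s' a _ ⟨c, mem_ball_self hr⟩ _ ⟨b, hclose s'⟩
  have hcd1 : Continuous (deriv γ₁) := h1.continuous_deriv le_rfl
  have hcd0 : Continuous (deriv γ₀) := h0.continuous_deriv le_rfl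
  have hi1 : Continuous fun s => f s (γ₁ s) * deriv γ₁ s := hc1.mul hcd1
  have hi0 : Continuous fun s => f s (γ₀ s) * deriv γ₀ s := hc0.mul hcd0
  have hIntg := intervalIntegral.integral_eq_sub_of_hasDerivAt (a := 0) (b := 1)
    (fun s _ => hP s) ((hi1.sub hi0).intervalIntegrable _ _)
  rw [intervalIntegral.integral_sub (hi1.intervalIntegrable _ _) (hi0.intervalIntegrable _ _)]
    at hIntg
  have e0 : γ₀ 1 = γ₀ 0 := by simpa using p0 0
  have e1 : γ₁ 1 = γ₁ 0 := by simpa using p1 0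
  have hk := key 0 1 (fun z _ => by rw [hper]) (γ₀ 0) ⟨mem_ball_self hr, by rw [e0]; exact mem_ball_self hr⟩
    (γ₁ 0) ⟨hclose 0, by rw [e0]; exact hclose 0⟩
  have : P 1 - P 0 = 0 := by
    simp only [P, e0, e1, hk, sub_self]
  rw [this] at hIntg
  exact sub_eq_zero.mp hIntg


/-- continuation of a branch value `w` over `E` (parameter `t0`) to `z` (parameter `t`) -/
def brn (t0 t E w z : ℂ) : ℂ :=
  w * csq ((z - t) / (E - t0)) / (csq ((z - I) / (E - I)) * csq ((z + I) / (E + I)))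

lemma brn_self {t0 t E w : ℂ} (h1 : E ≠ I) (h2 : E ≠ -I) :
    brn t0 t E w E = w * csq ((E - t) / (E - t0)) := by
  have a : E - I ≠ 0 := sub_ne_zero.mpr h1
  have b : E + I ≠ 0 := by intro h; exact h2 (eq_neg_of_add_eq_zero_left h)
  simp [brn, div_self a, div_self b, csq_one]

/-- `E` is `δ`-far from the branch points -/
def Far (δ : ℝ) (t0 E : ℂ) : Prop := δ ≤ ‖E - t0‖ ∧ δ ≤ ‖E - I‖ ∧ δ ≤ ‖E + I‖

lemma near_est {δ : ℝ} {t0 t E z : ℂ} (hF : Far δ t0 E) (ht : ‖t - t0‖ < δ / 2)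
    (hz : ‖z - E‖ < δ / 2) :
    ‖(z - t) - (E - t0)‖ < ‖E - t0‖ ∧ ‖(z - I) - (E - I)‖ < ‖E - I‖ ∧
      ‖(z + I) - (E + I)‖ < ‖E + I‖ := by
  obtain ⟨a, b, c⟩ := hF
  have hd : 0 < δ := by linarith [norm_nonneg (z - E)]
  refine ⟨?_, ?_, ?_⟩
  · have : (z - t) - (E - t0) = (z - E) - (t - t0) := by ring
    rw [this]
    linarith [norm_sub_le (z - E) (t - t0)]
  · rw [sub_sub_sub_cancel_right]; linarith
  · rw [add_sub_add_right_eq_sub]; linarith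

lemma brn_sq {δ : ℝ} {t0 t E w z : ℂ} (hF : Far δ t0 E) (ht : ‖t - t0‖ < δ / 2)
    (hz : ‖z - E‖ < δ / 2) (hw : w ^ 2 = (E - t0) / (4 * (E ^ 2 + 1))) :
    brn t0 t E w z ^ 2 = (z - t) / (4 * (z ^ 2 + 1)) := by
  obtain ⟨a, b, c⟩ := near_est hF ht hz
  have a1 := num_ne_of_ratio a
  have b1 := num_ne_of_ratio b
  have c1 := num_ne_of_ratio c
  have a0 := norm_pos_iff.mp (lt_of_le_of_lt (norm_nonneg _) a)
  have b0 := norm_pos_iff.mp (lt_of_le_of_lt (norm_nonneg _) b)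
  have c0 := norm_pos_iff.mp (lt_of_le_of_lt (norm_nonneg _) c)
  have e1 : E ^ 2 + 1 = (E - I) * (E + I) := by linear_combination Complex.I_sq
  have e2 : z ^ 2 + 1 = (z - I) * (z + I) := by linear_combination Complex.I_sq
  unfold brn
  rw [div_pow, mul_pow, mul_pow, csq_sq (div_ne_zero a1 a0), csq_sq (div_ne_zero b1 b0),
    csq_sq (div_ne_zero c1 c0), hw, e1, e2]
  field_simp

lemma brn_ne {δ : ℝ} {t0 t E w z : ℂ} (hF : Far δ t0 E) (hd : 0 < δ)
    (hw : w ^ 2 = (E - t0) / (4 * (E ^ 2 + 1))) : brn t0 t E w z ≠ 0 := by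
  obtain ⟨a, b, c⟩ := hF
  have a0 := norm_pos_iff.mp (lt_of_lt_of_le hd a)
  have b0 := norm_pos_iff.mp (lt_of_lt_of_le hd b)
  have c0 := norm_pos_iff.mp (lt_of_lt_of_le hd c)
  have e1 : E ^ 2 + 1 = (E - I) * (E + I) := by linear_combination Complex.I_sq
  have : w ≠ 0 := by
    rintro rfl
    rw [e1] at hw
    have : (E - t0) / (4 * ((E - I) * (E + I))) ≠ 0 :=
      div_ne_zero a0 (mul_ne_zero (by norm_num) (mul_ne_zero b0 c0))
    exact this (by rw [← hw]; simp)
  exact div_ne_zero (mul_ne_zero this (csq_ne _)) (mul_ne_zero (csq_ne _) (csq_ne _))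

lemma brn_differentiableOn {δ : ℝ} {t0 t E w : ℂ} (hF : Far δ t0 E) (ht : ‖t - t0‖ < δ / 2) :
    DifferentiableOn ℂ (brn t0 t E w) (ball E (δ / 2)) := by
  intro z hz
  rw [mem_ball, dist_eq_norm] at hz
  obtain ⟨a, b, c⟩ := near_est hF ht hz
  apply DifferentiableAt.differentiableWithinAt
  have da : DifferentiableAt ℂ (fun z => csq ((z - t) / (E - t0))) z :=
    DifferentiableAt.comp (g := csq) (f := fun z => (z - t) / (E - t0)) z
      (csq_hasDerivAt (ratio_mem a)).differentiableAt (by fun_prop)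
  have db : DifferentiableAt ℂ (fun z => csq ((z - I) / (E - I))) z :=
    DifferentiableAt.comp (g := csq) (f := fun z => (z - I) / (E - I)) z
      (csq_hasDerivAt (ratio_mem b)).differentiableAt (by fun_prop)
  have dc : DifferentiableAt ℂ (fun z => csq ((z + I) / (E + I))) z :=
    DifferentiableAt.comp (g := csq) (f := fun z => (z + I) / (E + I)) z
      (csq_hasDerivAt (ratio_mem c)).differentiableAt (by fun_prop)
  exact (da.const_mul w).div (db.mul dc) (mul_ne_zero (csq_ne _) (csq_ne _))

lemma brn_continuousAt {X : Type*} [TopologicalSpace X] {δ : ℝ} {t0 : ℂ} {t E w z : X → ℂ} {x : X}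
    (hF : Far δ t0 (E x)) (ht : ‖t x - t0‖ < δ / 2) (hz : ‖z x - E x‖ < δ / 2)
    (ct : ContinuousAt t x) (cE : ContinuousAt E x) (cw : ContinuousAt w x)
    (cz : ContinuousAt z x) : ContinuousAt (fun x => brn t0 (t x) (E x) (w x) (z x)) x := by
  obtain ⟨a, b, c⟩ := near_est hF ht hz
  have a0 := norm_pos_iff.mp (lt_of_le_of_lt (norm_nonneg _) a)
  have b0 := norm_pos_iff.mp (lt_of_le_of_lt (norm_nonneg _) b)
  have c0 := norm_pos_iff.mp (lt_of_le_of_lt (norm_nonneg _) c)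
  have da : ContinuousAt (fun x => csq ((z x - t x) / (E x - t0))) x :=
    ContinuousAt.comp' (f := fun x => (z x - t x) / (E x - t0))
      (csq_continuousAt (ratio_mem a)) ((cz.sub ct).div (cE.sub continuousAt_const) a0)
  have db : ContinuousAt (fun x => csq ((z x - I) / (E x - I))) x :=
    ContinuousAt.comp' (f := fun x => (z x - I) / (E x - I))
      (csq_continuousAt (ratio_mem b)) ((cz.sub continuousAt_const).div (cE.sub continuousAt_const) b0)
  have dc : ContinuousAt (fun x => csq ((z x + I) / (E x + I))) x :=
    ContinuousAt.comp' (f := fun x => (z x + I) / (E x + I))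
      (csq_continuousAt (ratio_mem c)) ((cz.add continuousAt_const).div (cE.add continuousAt_const) c0)
  exact (cw.mul da).div (db.mul dc) (mul_ne_zero (csq_ne _) (csq_ne _))

/-- transport of the integral of a branch between close loops -/
lemma branch_transport (t0 t : ℂ) (γ₀ γ₁ g₀ : ℝ → ℂ) (h0 : ContDiff ℝ 1 γ₀) (h1 : ContDiff ℝ 1 γ₁)
    (p0 : Function.Periodic γ₀ 1) (p1 : Function.Periodic γ₁ 1)
    (hg : Continuous g₀) (pg : Function.Periodic g₀ 1)
    (hg2 : ∀ s, g₀ s ^ 2 = (γ₀ s - t0) / (4 * (γ₀ s ^ 2 + 1)))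
    (δ : ℝ) (hd : 0 < δ) (hF : ∀ s, Far δ t0 (γ₀ s)) (ht : ‖t - t0‖ < δ / 2)
    (hclose : ∀ s, ‖γ₁ s - γ₀ s‖ < δ / 4) :
    ∫ s in (0:ℝ)..1, brn t0 t (γ₀ s) (g₀ s) (γ₁ s) * deriv γ₁ s
      = ∫ s in (0:ℝ)..1, g₀ s * csq ((γ₀ s - t) / (γ₀ s - t0)) * deriv γ₀ s := by
  have hc0 := h0.continuous
  have hc1 := h1.continuous
  have := close_loops γ₀ γ₁ h0 h1 p0 p1 (δ / 4) (by positivity)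
    (fun s => by rw [mem_ball, dist_eq_norm]; exact hclose s)
    (fun s z => brn t0 t (γ₀ s) (g₀ s) z)
    (fun s => (brn_differentiableOn (hF s) ht).mono (ball_subset_ball (by linarith)))
    ?_ ?_ ?_ ?_
  · rw [this]
    congr 1
    ext s
    obtain ⟨-, b, c⟩ := hF s
    have b0 := norm_pos_iff.mp (lt_of_lt_of_le hd b)
    have c0 := norm_pos_iff.mp (lt_of_lt_of_le hd c)
    rw [brn_self (sub_ne_zero.mp b0) (fun h => c0 (by rw [h]; simp))]
  · intro s
    obtain ⟨ε, he, hε⟩ := Metric.continuousAt_iff.mp (hc0.continuousAt (x := s)) (δ / 4) (by positivity)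
    filter_upwards [ball_mem_nhds s he] with s' hs' z hz
    have hzz : ∀ x ∈ ball s ε, ‖z - γ₀ x‖ < δ / 2 := by
      intro x hx
      have h1 := hε hx
      rw [mem_ball] at hz
      have := dist_triangle z (γ₀ s) (γ₀ x)
      rw [dist_comm (γ₀ s)] at this
      rw [← dist_eq_norm]
      linarith
    have := IsPreconnected.eq_of_sq_eq (S := ball s ε) (f := fun x => brn t0 t (γ₀ x) (g₀ x) z)
      (g := fun _ => brn t0 t (γ₀ s) (g₀ s) z) (convex_ball s ε).isPreconnected
      (fun x hx => (brn_continuousAt (hF x) ht (hzz x hx) continuousAt_const hc0.continuousAt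
        hg.continuousAt continuousAt_const).continuousWithinAt)
      continuousOn_const
      (fun x hx => by
        simp only [Pi.pow_apply]
        rw [brn_sq (hF x) ht (hzz x hx) (hg2 x),
          brn_sq (hF s) ht (hzz s (mem_ball_self he)) (hg2 s)])
      (fun {x} hx => brn_ne (hF s) hd (hg2 s)) (mem_ball_self he) rfl
    exact this hs'
  · have e0 : γ₀ 1 = γ₀ 0 := by simpa using p0 0
    have e1 : g₀ 1 = g₀ 0 := by simpa using pg 0
    ext z; simp only [e0, e1]
  · refine continuous_iff_continuousAt.mpr fun s => ?_
    exact brn_continuousAt (hF s) ht (by simpa using hd) continuousAt_const hc0.continuousAt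
        hg.continuousAt hc0.continuousAt
  · refine continuous_iff_continuousAt.mpr fun s => ?_
    exact brn_continuousAt (hF s) ht (by linarith [hclose s]) continuousAt_const hc0.continuousAt
        hg.continuousAt hc1.continuousAt

/-- a property holding on `[0,1]` in a periodic fashion -/
lemma per_forall {P : ℝ → Prop} (hP : ∀ s, P (Int.fract s) → P s)
    (h : ∀ s ∈ Icc (0:ℝ) 1, P s) : ∀ s, P s := fun s =>
  hP s (h _ ⟨Int.fract_nonneg s, (Int.fract_lt_one s).le⟩)

lemma per_fract {f : ℝ → ℂ} (hf : Function.Periodic f 1) (s : ℝ) : f (Int.fract s) = f s := by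
  have := hf.sub_int_mul_eq (x := s) ⌊s⌋
  rwa [mul_one] at this

lemma exists_far (t0 : ℂ) (γ : ℝ → ℂ) (hc : Continuous γ) (p : Function.Periodic γ 1)
    (h : ∀ s, γ s ≠ I ∧ γ s ≠ -I ∧ γ s ≠ t0) : ∃ δ > 0, ∀ s, Far δ t0 (γ s) := by
  let m : ℝ → ℝ := fun s => min ‖γ s - t0‖ (min ‖γ s - I‖ ‖γ s + I‖)
  have hm : Continuous m := by fun_prop
  obtain ⟨x, -, hx⟩ := (isCompact_Icc (a := (0:ℝ)) (b := 1)).exists_isMinOn ⟨0, by simp⟩ hm.continuousOn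
  refine ⟨m x, ?_, ?_⟩
  · obtain ⟨a, b, c⟩ := h x
    refine lt_min (norm_pos_iff.mpr (sub_ne_zero.mpr c))
      (lt_min (norm_pos_iff.mpr (sub_ne_zero.mpr a)) (norm_pos_iff.mpr ?_))
    intro h; exact b (eq_neg_of_add_eq_zero_left h)
  · refine per_forall (fun s hs => by rwa [per_fract p] at hs) fun s hs => ?_
    have : m x ≤ m s := hx hs
    have h2 : m x ≤ min ‖γ s - t0‖ (min ‖γ s - I‖ ‖γ s + I‖) := this
    rw [le_min_iff, le_min_iff] at h2
    exact h2

lemma local_rep (Γ : ℝ → ℝ → ℂ) (g : ℝ → ℝ → ℂ)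
    (hΓcont : Continuous (Function.uncurry Γ))
    (hΓloop : ∀ t : ℝ, ContDiff ℝ 1 (Γ t) ∧ Function.Periodic (Γ t) 1 ∧
      ∀ s : ℝ, Γ t s ≠ Complex.I ∧ Γ t s ≠ -Complex.I ∧ Γ t s ≠ (t : ℂ))
    (hgcont : Continuous (Function.uncurry g))
    (hg : ∀ t : ℝ, Function.Periodic (g t) 1 ∧
      ∀ s : ℝ, g t s ^ 2 = (Γ t s - (t : ℂ)) / (4 * ((Γ t s) ^ 2 + 1))) (t0 : ℝ) :
    ∃ δ > 0, (∀ s, Far δ t0 (Γ t0 s)) ∧ ∀ᶠ t : ℝ in 𝓝 t0,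
      ∫ s in (0:ℝ)..1, g t s * deriv (Γ t) s =
        ∫ s in (0:ℝ)..1, g t0 s * csq ((Γ t0 s - t) / (Γ t0 s - t0)) * deriv (Γ t0) s := by
  have hgc : ∀ t, Continuous (g t) := fun t => by
    have : Continuous fun s => Function.uncurry g (t, s) := by fun_prop
    exact this
  have hΓc : ∀ t, Continuous (Γ t) := fun t => (hΓloop t).1.continuous
  obtain ⟨δ, hd, hF⟩ := exists_far t0 (Γ t0) (hΓc t0) (hΓloop t0).2.1 (hΓloop t0).2.2
  refine ⟨δ, hd, hF, ?_⟩
  have hcl : ∀ᶠ t in 𝓝 t0, ∀ s ∈ Icc (0:ℝ) 1, ‖Γ t s - Γ t0 s‖ < δ / 4 := by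
    refine isCompact_Icc.eventually_forall_of_forall_eventually fun s _ => ?_
    have hc : Continuous fun z : ℝ × ℝ => ‖Function.uncurry Γ z - Γ t0 z.2‖ :=
      (hΓcont.sub ((hΓc t0).comp continuous_snd)).norm
    exact hc.continuousAt.eventually (Iio_mem_nhds (by simpa [Function.uncurry] using hd))
  obtain ⟨ε, he, hε⟩ := Metric.eventually_nhds_iff_ball.mp hcl
  have hε' : ∀ t ∈ ball t0 ε, ∀ s, ‖Γ t s - Γ t0 s‖ < δ / 4 := fun t ht =>
    per_forall (fun s hs => by rwa [per_fract (hΓloop t).2.1, per_fract (hΓloop t0).2.1] at hs) (hε t ht)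
  set ρ := min ε (δ / 2) with hρ
  have hρ0 : 0 < ρ := lt_min he (by positivity)
  have htt : ∀ t ∈ ball t0 ρ, ‖(t:ℂ) - t0‖ < δ / 2 := fun t ht => by
    rw [mem_ball, Real.dist_eq] at ht
    rw [← Complex.ofReal_sub, Complex.norm_real, Real.norm_eq_abs]
    exact lt_of_lt_of_le ht (min_le_right _ _)
  have hte : ∀ t ∈ ball t0 ρ, t ∈ ball t0 ε := fun t ht =>
    ball_subset_ball (min_le_left _ _) ht
  have heq := IsPreconnected.eq_of_sq_eq (S := ball t0 ρ ×ˢ (univ : Set ℝ))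
      (f := fun x => Function.uncurry g x)
      (g := fun x => brn t0 (x.1 : ℂ) (Γ t0 x.2) (g t0 x.2) (Function.uncurry Γ x))
      ((convex_ball t0 ρ).isPreconnected.prod isPreconnected_univ)
      hgcont.continuousOn
      (fun x hx => (brn_continuousAt (t := fun x : ℝ × ℝ => (x.1 : ℂ))
        (E := fun x : ℝ × ℝ => Γ t0 x.2) (w := fun x : ℝ × ℝ => g t0 x.2)
        (z := Function.uncurry Γ) (hF x.2) (htt _ hx.1)
        (lt_trans (hε' x.1 (hte _ hx.1) x.2) (by linarith)) (by fun_prop)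
        ((hΓc t0).comp continuous_snd).continuousAt ((hgc t0).comp continuous_snd).continuousAt
        hΓcont.continuousAt).continuousWithinAt)
      (fun x hx => by
        simp only [Pi.pow_apply]
        rw [brn_sq (z := Function.uncurry Γ x) (hF x.2) (htt _ hx.1)
          (lt_trans (hε' x.1 (hte _ hx.1) x.2) (by linarith)) ((hg t0).2 x.2)]
        exact (hg x.1).2 x.2)
      (fun {x} hx => brn_ne (hF x.2) hd ((hg t0).2 x.2)) (y := (t0, 0))
      ⟨mem_ball_self hρ0, mem_univ _⟩ (by
        have hl := (hΓloop t0).2.2 0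
        simp only [Function.uncurry]
        rw [brn_self hl.1 hl.2.1, div_self (sub_ne_zero.mpr hl.2.2), csq_one, mul_one])
  filter_upwards [ball_mem_nhds t0 hρ0] with t ht
  rw [← branch_transport t0 t (Γ t0) (Γ t) (g t0) (hΓloop t0).1 (hΓloop t).1 (hΓloop t0).2.1
    (hΓloop t).2.1 (hgc t0) (hg t0).1 (hg t0).2 δ hd hF (htt t ht) (hε' t (hte t ht))]
  congr 1
  ext s
  have := heq (x := (t, s)) ⟨ht, mem_univ _⟩
  simp only [Function.uncurry] at this
  rw [this]


lemma loc_hasDerivAt (t0 : ℂ) (γ g₀ d : ℝ → ℂ) (hγ : Continuous γ) (hg : Continuous g₀)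
    (hdc : Continuous d) (δ : ℝ) (hd : 0 < δ) (hF : ∀ s, δ ≤ ‖γ s - t0‖) (t : ℂ)
    (ht : t ∈ ball t0 (δ / 2)) :
    HasDerivAt (fun t : ℂ => ∫ s in (0:ℝ)..1, g₀ s * csq ((γ s - t) / (γ s - t0)) * d s)
      (∫ s in (0:ℝ)..1, -(1 / 2) * (g₀ s * csq ((γ s - t) / (γ s - t0)) / (γ s - t) * d s)) t := by
  have hr : ∀ x ∈ closedBall t0 (δ / 2), ∀ s, ‖(γ s - x) - (γ s - t0)‖ < ‖γ s - t0‖ := by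
    intro x hx s
    rw [sub_sub_sub_cancel_left, ← dist_eq_norm, dist_comm]
    rw [mem_closedBall] at hx
    linarith [hF s]
  have h0 : ∀ s, γ s - t0 ≠ 0 := fun s => norm_pos_iff.mp (lt_of_lt_of_le hd (hF s))
  have hcA : ∀ x ∈ closedBall t0 (δ / 2), ∀ s,
      ContinuousAt (fun p : ℂ × ℝ => csq ((γ p.2 - p.1) / (γ p.2 - t0))) (x, s) := by
    intro x hx s
    refine ContinuousAt.comp' (f := fun p : ℂ × ℝ => (γ p.2 - p.1) / (γ p.2 - t0))
      (csq_continuousAt (ratio_mem (hr x hx s))) (ContinuousAt.div ?_ ?_ (h0 s)) <;> fun_prop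
  have hcs : ∀ x ∈ closedBall t0 (δ / 2), Continuous fun s => csq ((γ s - x) / (γ s - t0)) := by
    intro x hx
    refine continuous_iff_continuousAt.mpr fun s => ?_
    exact ContinuousAt.comp' (f := fun s : ℝ => (x, s)) (hcA x hx s) (by fun_prop)
  let F' : ℂ → ℝ → ℂ := fun x s =>
    -(1 / 2) * (g₀ s * csq ((γ s - x) / (γ s - t0)) / (γ s - x) * d s)
  have hF'c : ∀ x ∈ closedBall t0 (δ / 2), ∀ s, ContinuousAt (Function.uncurry F') (x, s) := by
    intro x hx s
    have hgs : ContinuousAt (fun p : ℂ × ℝ => g₀ p.2) (x, s) := by fun_prop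
    have hds : ContinuousAt (fun p : ℂ × ℝ => d p.2) (x, s) := by fun_prop
    have hγs : ContinuousAt (fun p : ℂ × ℝ => γ p.2 - p.1) (x, s) := by fun_prop
    exact continuousAt_const.mul (((hgs.mul (hcA x hx s)).div hγs
      (num_ne_of_ratio (hr x hx s))).mul hds)
  obtain ⟨C, hC⟩ := ((isCompact_closedBall t0 (δ / 2)).prod
    (isCompact_Icc (a := (0:ℝ)) (b := 1))).exists_bound_of_continuousOn
    (f := Function.uncurry F') (fun p hp => (hF'c p.1 hp.1 p.2).continuousWithinAt)
  have hsub : ball t0 (δ / 2) ⊆ closedBall t0 (δ / 2) := ball_subset_closedBall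
  refine (intervalIntegral.hasDerivAt_integral_of_dominated_loc_of_deriv_le (F' := F')
    (bound := fun _ => C) (isOpen_ball.mem_nhds ht) ?_ ?_ ?_ ?_ ?_ ?_).2
  · filter_upwards [isOpen_ball.mem_nhds ht] with x hx
    exact ((hg.mul (hcs x (hsub hx))).mul hdc).aestronglyMeasurable
  · exact ((hg.mul (hcs t (hsub ht))).mul hdc).intervalIntegrable _ _
  · refine Continuous.aestronglyMeasurable ?_
    refine continuous_iff_continuousAt.mpr fun s => ?_
    exact ContinuousAt.comp' (f := fun s : ℝ => (t, s)) (hF'c t (hsub ht) s) (by fun_prop)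
  · refine Eventually.of_forall fun s hs x hx => ?_
    rw [uIoc_of_le zero_le_one] at hs
    exact hC (x, s) ⟨hsub hx, Ioc_subset_Icc_self hs⟩
  · exact intervalIntegrable_const
  · refine Eventually.of_forall fun s hs x hx => ?_
    have h1 : HasDerivAt (fun x => (γ s - x) / (γ s - t0)) (-1 / (γ s - t0)) x := by
      simpa using ((hasDerivAt_id x).const_sub (γ s)).div_const (γ s - t0)
    have h2 := ((HasDerivAt.comp (h₂ := csq) (h := fun x => (γ s - x) / (γ s - t0)) x (csq_hasDerivAt (ratio_mem (hr x (hsub hx) s))) h1).const_mul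
      (g₀ s)).mul_const (d s)
    refine h2.congr_deriv ?_
    have := num_ne_of_ratio (hr x (hsub hx) s)
    have := h0 s
    simp only [F']
    field_simp

lemma analyticAt_of_complex {F : ℂ → ℂ} {t0 : ℝ} {ε : ℝ} (hε : 0 < ε)
    (hF : ∀ t ∈ ball (t0 : ℂ) ε, DifferentiableAt ℂ F t) :
    AnalyticAt ℝ (fun t : ℝ => F t) t0 := by
  have h1 : AnalyticAt ℂ F (t0 : ℂ) :=
    DifferentiableOn.analyticAt (s := ball (t0 : ℂ) ε)
      (fun t ht => (hF t ht).differentiableWithinAt) (ball_mem_nhds _ hε)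
  have h2 : AnalyticAt ℝ F (t0 : ℂ) := h1.restrictScalars
  exact h2.fun_comp (f := fun t : ℝ => (t : ℂ)) (Complex.ofRealCLM.analyticAt t0)


lemma csq_re_nonneg (z : ℂ) : 0 ≤ (csq z).re := by
  unfold csq
  rw [Complex.exp_re]
  refine mul_nonneg (Real.exp_pos _).le (Real.cos_nonneg_of_mem_Icc ?_)
  have : (Complex.log z / 2).im = Complex.arg z / 2 := by simp [Complex.log_im]
  rw [this]
  constructor
  · linarith [Complex.neg_pi_lt_arg z]
  · linarith [Complex.arg_le_pi z]

lemma csq_norm_sq {z : ℂ} (hz : z ≠ 0) : ‖csq z‖ ^ 2 = ‖z‖ := by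
  rw [← norm_pow, csq_sq hz]

lemma csq_ofReal {x : ℝ} (hx : 0 < x) : csq (x : ℂ) = (Real.sqrt x : ℂ) := by
  unfold csq
  rw [← Complex.ofReal_log hx.le, Real.sqrt_eq_rpow, Real.rpow_def_of_pos hx]
  push_cast
  congr 1; ring

lemma A_bound {x M u : ℝ} (hx : |x| ≤ M) :
    (1 + u ^ 2) ^ 2 ≤ (2 + 3 * (1 + M) ^ 2) * ((x + u ^ 2) ^ 2 + 3 / 4) := by
  have hM : 0 ≤ M := (abs_nonneg _).trans hx
  obtain ⟨h1, h2⟩ := abs_le.mp hx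
  have h3 : (1 - x) ^ 2 ≤ (1 + M) ^ 2 := by
    apply sq_le_sq' <;> linarith
  have h4 : (1 + u ^ 2) ^ 2 ≤ 2 * (x + u ^ 2) ^ 2 + 2 * (1 - x) ^ 2 := by
    nlinarith [sq_nonneg ((x + u ^ 2) - (1 - x))]
  nlinarith [mul_nonneg (sq_nonneg (1 + M)) (sq_nonneg (x + u ^ 2))]

def X0 (t : ℂ) (u : ℝ) : ℂ := (t + (u:ℂ) ^ 2) ^ 2 + 1

lemma X0_re {t : ℂ} (ht : |t.im| < 1 / 2) (u : ℝ) :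
    (t.re + u ^ 2) ^ 2 + 3 / 4 ≤ (X0 t u).re := by
  have : (X0 t u).re = (t.re + u ^ 2) ^ 2 - t.im ^ 2 + 1 := by
    unfold X0
    rw [← Complex.ofReal_pow]
    simp [sq]
  rw [this]
  obtain ⟨a, b⟩ := abs_lt.mp ht
  nlinarith

lemma X0_re_pos {t : ℂ} (ht : |t.im| < 1 / 2) (u : ℝ) : 0 < (X0 t u).re :=
  lt_of_lt_of_le (by positivity) (X0_re ht u)

lemma X0_mem {t : ℂ} (ht : |t.im| < 1 / 2) (u : ℝ) : X0 t u ∈ slitPlane :=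
  Or.inl (X0_re_pos ht u)

lemma X0_norm {t : ℂ} (ht : |t.im| < 1 / 2) (u : ℝ) :
    (t.re + u ^ 2) ^ 2 + 3 / 4 ≤ ‖X0 t u‖ := (X0_re ht u).trans (Complex.re_le_norm _)

lemma num_norm {t : ℂ} (ht : |t.im| < 1 / 2) (u : ℝ) : ‖t + (u:ℂ) ^ 2‖ ≤ ‖csq (X0 t u)‖ := by
  refine (sq_le_sq₀ (norm_nonneg _) (norm_nonneg _)).mp ?_
  rw [csq_norm_sq (Complex.slitPlane_ne_zero (X0_mem ht u))]
  refine le_trans ?_ (X0_norm ht u)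
  rw [← Complex.normSq_eq_norm_sq, Complex.normSq_apply, ← Complex.ofReal_pow]
  simp only [Complex.add_re, Complex.add_im, Complex.ofReal_re, Complex.ofReal_im]
  obtain ⟨a, b⟩ := abs_lt.mp ht
  nlinarith

def K0 (t : ℂ) (u : ℝ) : ℂ := (u:ℂ) ^ 2 / csq (X0 t u) - 1
def K1 (t : ℂ) (u : ℝ) : ℂ := -((u:ℂ) ^ 2 * (t + (u:ℂ) ^ 2) / (csq (X0 t u) * X0 t u))

lemma csq_X0_cont {t : ℂ} (ht : |t.im| < 1 / 2) : Continuous fun u => csq (X0 t u) := by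
  refine continuous_iff_continuousAt.mpr fun u => ?_
  exact ContinuousAt.comp' (f := X0 t) (csq_continuousAt (X0_mem ht u))
    (by unfold X0; fun_prop)

lemma K0_cont {t : ℂ} (ht : |t.im| < 1 / 2) : Continuous (K0 t) :=
  (Continuous.div (by fun_prop) (csq_X0_cont ht) (fun _ => csq_ne _)).sub continuous_const

lemma K1_cont {t : ℂ} (ht : |t.im| < 1 / 2) : Continuous (K1 t) :=
  (Continuous.div (by fun_prop) ((csq_X0_cont ht).mul (by unfold X0; fun_prop))
    (fun u => mul_ne_zero (csq_ne _) (Complex.slitPlane_ne_zero (X0_mem ht u)))).neg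

lemma K1_bound {t : ℂ} (ht : |t.im| < 1 / 2) {M : ℝ} (hM : |t.re| ≤ M) (u : ℝ) :
    ‖K1 t u‖ ≤ (2 + 3 * (1 + M) ^ 2) * (1 + u ^ 2)⁻¹ := by
  have h1 := num_norm ht u
  have h2 := X0_norm ht u
  have h3 := A_bound (u := u) hM
  have hc : 0 < ‖csq (X0 t u)‖ := norm_pos_iff.mpr (csq_ne _)
  have hA : 0 < (t.re + u ^ 2) ^ 2 + 3 / 4 := by positivity
  unfold K1
  rw [norm_neg, norm_div, norm_mul, norm_mul, norm_pow, Complex.norm_real, Real.norm_eq_abs, sq_abs]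
  calc u ^ 2 * ‖t + (u:ℂ) ^ 2‖ / (‖csq (X0 t u)‖ * ‖X0 t u‖)
      ≤ u ^ 2 * ‖csq (X0 t u)‖ / (‖csq (X0 t u)‖ * ((t.re + u ^ 2) ^ 2 + 3 / 4)) := by gcongr
    _ = u ^ 2 / ((t.re + u ^ 2) ^ 2 + 3 / 4) := by field_simp
    _ ≤ _ := by
      rw [← div_eq_mul_inv, div_le_div_iff₀ hA (by positivity)]
      nlinarith [sq_nonneg u]

lemma K0_bound {t : ℂ} (ht : |t.im| < 1 / 2) {M : ℝ} (hM : |t.re| ≤ M) (u : ℝ) :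
    ‖K0 t u‖ ≤ ((2 * ‖t‖ + ‖t‖ ^ 2 + 1) * (2 + 3 * (1 + M) ^ 2)) * (1 + u ^ 2)⁻¹ := by
  have h2 := X0_norm ht u
  have h3 := A_bound (u := u) hM
  have hX := Complex.slitPlane_ne_zero (X0_mem ht u)
  set c := csq (X0 t u) with hcdef
  have hcn : c ≠ 0 := csq_ne _
  have hc : 0 < ‖c‖ := norm_pos_iff.mpr hcn
  have hc2 : c ^ 2 = X0 t u := csq_sq hX
  have hA : 0 < (t.re + u ^ 2) ^ 2 + 3 / 4 := by positivity
  have hge : ‖c‖ ≤ ‖(u:ℂ) ^ 2 + c‖ := by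
    refine (sq_le_sq₀ (norm_nonneg _) (norm_nonneg _)).mp ?_
    rw [← Complex.normSq_eq_norm_sq, ← Complex.normSq_eq_norm_sq, Complex.normSq_apply,
      Complex.normSq_apply, ← Complex.ofReal_pow]
    simp only [Complex.add_re, Complex.add_im, Complex.ofReal_re, Complex.ofReal_im]
    have := csq_re_nonneg (X0 t u)
    rw [← hcdef] at this
    nlinarith [mul_nonneg (sq_nonneg u) this, sq_nonneg (u ^ 2)]
  have hne : (u:ℂ) ^ 2 + c ≠ 0 := norm_pos_iff.mp (lt_of_lt_of_le hc hge)
  have e : K0 t u = -(2 * t * (u:ℂ) ^ 2 + t ^ 2 + 1) / (c * ((u:ℂ) ^ 2 + c)) := by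
    unfold K0
    rw [← hcdef]
    field_simp
    unfold X0 at hc2
    linear_combination -hc2
  have hprod : (t.re + u ^ 2) ^ 2 + 3 / 4 ≤ ‖c‖ * ‖(u:ℂ) ^ 2 + c‖ := by
    calc _ ≤ ‖X0 t u‖ := h2
      _ = ‖c‖ * ‖c‖ := by rw [← hc2, norm_pow, sq]
      _ ≤ _ := by gcongr
  have hnum : ‖2 * t * (u:ℂ) ^ 2 + t ^ 2 + 1‖ ≤ (2 * ‖t‖ + ‖t‖ ^ 2 + 1) * (1 + u ^ 2) := by
    have a1 := norm_add_le (2 * t * (u:ℂ) ^ 2 + t ^ 2) 1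
    have a2 := norm_add_le (2 * t * (u:ℂ) ^ 2) (t ^ 2)
    have a3 : ‖2 * t * (u:ℂ) ^ 2‖ = 2 * ‖t‖ * u ^ 2 := by
      rw [norm_mul, norm_mul, norm_pow, Complex.norm_real, Real.norm_eq_abs, sq_abs]; simp
    rw [norm_one] at a1
    rw [a3, norm_pow] at a2
    nlinarith [norm_nonneg t, sq_nonneg u, mul_nonneg (sq_nonneg ‖t‖) (sq_nonneg u)]
  rw [e, norm_div, norm_neg, norm_mul]
  have hT : 0 ≤ 2 * ‖t‖ + ‖t‖ ^ 2 + 1 := by positivity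
  calc _ ≤ (2 * ‖t‖ + ‖t‖ ^ 2 + 1) * (1 + u ^ 2) / ((t.re + u ^ 2) ^ 2 + 3 / 4) := by gcongr
    _ ≤ _ := by
      rw [← div_eq_mul_inv, div_le_div_iff₀ hA (by positivity)]
      nlinarith [mul_le_mul_of_nonneg_left h3 hT]

lemma bound_int (C : ℝ) : MeasureTheory.IntegrableOn (fun u : ℝ => C * (1 + u ^ 2)⁻¹) (Ioi 0) :=
  (integrable_inv_one_add_sq.const_mul C).integrableOn

lemma K0_int {t : ℂ} (ht : |t.im| < 1 / 2) : MeasureTheory.IntegrableOn (K0 t) (Ioi 0) :=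
  (bound_int _).mono' (K0_cont ht).aestronglyMeasurable
    (Eventually.of_forall fun u => K0_bound ht le_rfl u)

lemma K1_int {t : ℂ} (ht : |t.im| < 1 / 2) : MeasureTheory.IntegrableOn (K1 t) (Ioi 0) :=
  (bound_int _).mono' (K1_cont ht).aestronglyMeasurable
    (Eventually.of_forall fun u => K1_bound ht le_rfl u)

lemma K0_hasDerivAt {t : ℂ} (ht : |t.im| < 1 / 2) (u : ℝ) :
    HasDerivAt (fun t => K0 t u) (K1 t u) t := by
  have hX := Complex.slitPlane_ne_zero (X0_mem ht u)
  have h1 : HasDerivAt (fun t => X0 t u) (2 * (t + (u:ℂ) ^ 2)) t := by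
    unfold X0
    simpa using (((hasDerivAt_id t).add_const ((u:ℂ) ^ 2)).pow 2).add_const 1
  have h2 := HasDerivAt.comp t (csq_hasDerivAt (X0_mem ht u)) h1
  have h3 := ((hasDerivAt_const t ((u:ℂ) ^ 2)).div h2 (csq_ne _)).sub_const 1
  refine h3.congr_deriv ?_
  have := csq_ne (X0 t u)
  simp only [K1, Function.comp]
  field_simp
  ring

def P0 (t : ℂ) : ℂ := 2 * ∫ u in Ioi (0:ℝ), K0 t u

lemma P0_hasDerivAt {t : ℂ} (ht : |t.im| < 1 / 2) :
    HasDerivAt P0 (2 * ∫ u in Ioi (0:ℝ), K1 t u) t := by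
  let S : Set ℂ := {x | |x.im| < 1 / 2 ∧ |x.re| < |t.re| + 1}
  have hS : IsOpen S := by
    have a : IsOpen {x : ℂ | |x.im| < 1 / 2} := isOpen_lt (by fun_prop) (by fun_prop)
    have b : IsOpen {x : ℂ | |x.re| < |t.re| + 1} := isOpen_lt (by fun_prop) (by fun_prop)
    exact a.inter b
  have hmem : S ∈ 𝓝 t := hS.mem_nhds ⟨ht, by linarith⟩
  refine HasDerivAt.const_mul 2 ?_
  refine (_root_.hasDerivAt_integral_of_dominated_loc_of_deriv_le (F' := K1)
    (bound := fun u => (2 + 3 * (1 + (|t.re| + 1)) ^ 2) * (1 + u ^ 2)⁻¹) hmem ?_ ?_ ?_ ?_ ?_ ?_).2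
  · filter_upwards [hmem] with x hx using (K0_cont hx.1).aestronglyMeasurable
  · exact K0_int ht
  · exact (K1_cont ht).aestronglyMeasurable
  · exact Eventually.of_forall fun u x hx => K1_bound hx.1 hx.2.le u
  · exact bound_int _
  · exact Eventually.of_forall fun u x hx => K0_hasDerivAt hx.1 u


def Sr (t u : ℝ) : ℝ := Real.sqrt ((t + u ^ 2) ^ 2 + 1)

lemma Sr_pos (t u : ℝ) : 0 < Sr t u := Real.sqrt_pos.mpr (by positivity)

lemma Sr_sq (t u : ℝ) : Sr t u ^ 2 = (t + u ^ 2) ^ 2 + 1 := Real.sq_sqrt (by positivity)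

lemma Sr_cont (t : ℝ) : Continuous (Sr t) := by unfold Sr; fun_prop

lemma X0_real (t u : ℝ) : X0 (t:ℂ) u = (((t + u ^ 2) ^ 2 + 1 : ℝ) : ℂ) := by
  unfold X0; push_cast; rfl

lemma csq_X0_real (t u : ℝ) : csq (X0 (t:ℂ) u) = (Sr t u : ℂ) := by
  rw [X0_real, csq_ofReal (by positivity)]; rfl

lemma im_real (t : ℝ) : |((t:ℝ):ℂ).im| < 1 / 2 := by simp

def Fr (t : ℝ) : ℝ := 2 * ∫ u in Ioi (0:ℝ), (u ^ 2 / Sr t u - 1)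
def Jr (t : ℝ) : ℝ := ∫ u in Ioi (0:ℝ), 1 / Sr t u

lemma K0_real (t u : ℝ) : K0 (t:ℂ) u = ((u ^ 2 / Sr t u - 1 : ℝ) : ℂ) := by
  unfold K0; rw [csq_X0_real]; push_cast; rfl

lemma K1_real (t u : ℝ) : K1 (t:ℂ) u = ((-(u ^ 2 * (t + u ^ 2) / (Sr t u * Sr t u ^ 2)) : ℝ) : ℂ) := by
  unfold K1; rw [csq_X0_real, X0_real, Sr_sq]; push_cast; rfl

lemma P0_real (t : ℝ) : P0 (t:ℂ) = (Fr t : ℂ) := by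
  unfold P0 Fr
  simp only [K0_real]
  rw [integral_complex_ofReal]; push_cast; rfl

lemma Fr_int (t : ℝ) : MeasureTheory.IntegrableOn (fun u => u ^ 2 / Sr t u - 1) (Ioi 0) := by
  have := (K0_int (im_real t)).re
  refine this.congr (Eventually.of_forall fun u => ?_)
  simp only [K0_real]
  exact Complex.ofReal_re _

lemma K1r_int (t : ℝ) : MeasureTheory.IntegrableOn
    (fun u => u ^ 2 * (t + u ^ 2) / (Sr t u * Sr t u ^ 2)) (Ioi 0) := by
  have := (K1_int (im_real t)).re.neg
  refine this.congr (Eventually.of_forall fun u => ?_)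
  simp only [K1_real, Pi.neg_apply]
  rw [neg_eq_iff_eq_neg]
  exact Complex.ofReal_re _

lemma Sr_lower (t : ℝ) : ∃ C > 0, ∀ u, 1 / Sr t u ≤ C * (1 + u ^ 2)⁻¹ := by
  refine ⟨Real.sqrt (2 + 3 * (1 + |t|) ^ 2), Real.sqrt_pos.mpr (by positivity), fun u => ?_⟩
  have h := A_bound (u := u) (le_refl |t|)
  rw [← div_eq_mul_inv, div_le_div_iff₀ (Sr_pos t u) (by positivity), one_mul]
  unfold Sr
  rw [← Real.sqrt_mul (by positivity)]
  apply Real.le_sqrt_of_sq_le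
  refine h.trans ?_
  gcongr
  norm_num

lemma Jr_int (t : ℝ) : MeasureTheory.IntegrableOn (fun u => 1 / Sr t u) (Ioi 0) := by
  obtain ⟨C, hC, h⟩ := Sr_lower t
  refine (bound_int C).mono' (Continuous.div continuous_const (Sr_cont t)
    (fun u => (Sr_pos t u).ne')).aestronglyMeasurable (Eventually.of_forall fun u => ?_)
  rw [Real.norm_of_nonneg (by have := Sr_pos t u; positivity)]
  exact h u

lemma pos_int {f : ℝ → ℝ} (hf : ∀ u, 0 < f u) (hi : MeasureTheory.IntegrableOn f (Ioi 0)) :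
    0 < ∫ u in Ioi (0:ℝ), f u := by
  rw [MeasureTheory.setIntegral_pos_iff_support_of_nonneg_ae
    (Eventually.of_forall fun u => (hf u).le) hi]
  have : Function.support f = univ := by
    ext u; simp [(hf u).ne']
  rw [this, univ_inter, Real.volume_Ioi]
  exact ENNReal.zero_lt_top

lemma Jr_pos (t : ℝ) : 0 < Jr t :=
  pos_int (fun u => one_div_pos.mpr (Sr_pos t u)) (Jr_int t)

lemma Sr_hasDerivAt (t u : ℝ) : HasDerivAt (fun u => u / Sr t u)
    (1 / Sr t u - 2 * (u ^ 2 * (t + u ^ 2) / (Sr t u * Sr t u ^ 2))) u := by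
  have h0 : (t + u ^ 2) ^ 2 + 1 ≠ 0 := by positivity
  have h1 : HasDerivAt (fun u : ℝ => (t + u ^ 2) ^ 2 + 1) (2 * (t + u ^ 2) * (2 * u)) u := by
    simpa using (((hasDerivAt_pow 2 u).const_add t).pow 2).add_const 1
  have h2 := (hasDerivAt_id u).div (h1.sqrt h0) (Sr_pos t u).ne'
  refine h2.congr_deriv ?_
  have := (Sr_pos t u).ne'
  change (1 * Sr t u - u * (2 * (t + u ^ 2) * (2 * u) / (2 * Sr t u))) / Sr t u ^ 2 = _
  field_simp

lemma by_parts (t : ℝ) :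
    2 * ∫ u in Ioi (0:ℝ), u ^ 2 * (t + u ^ 2) / (Sr t u * Sr t u ^ 2) = Jr t := by
  have hlim : Tendsto (fun u => u / Sr t u) atTop (𝓝 0) := by
    obtain ⟨C, hC, h⟩ := Sr_lower t
    have hz : Tendsto (fun u : ℝ => C * u⁻¹) atTop (𝓝 0) := by
      simpa using tendsto_inv_atTop_zero.const_mul C
    refine tendsto_of_tendsto_of_tendsto_of_le_of_le' tendsto_const_nhds hz ?_ ?_
    · filter_upwards [eventually_gt_atTop 0] with u hu
      have := Sr_pos t u; positivity
    · filter_upwards [eventually_gt_atTop 0] with u hu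
      have h1 := mul_le_mul_of_nonneg_left (h u) hu.le
      have h2 : u * (C * (1 + u ^ 2)⁻¹) ≤ C * u⁻¹ := by
        rw [← div_eq_mul_inv, ← div_eq_mul_inv, ← mul_div_assoc, div_le_div_iff₀ (by positivity) hu]
        nlinarith
      calc u / Sr t u = u * (1 / Sr t u) := by ring
        _ ≤ _ := h1.trans h2
  have := MeasureTheory.integral_Ioi_of_hasDerivAt_of_tendsto' (a := 0)
    (fun u _ => Sr_hasDerivAt t u) ((Jr_int t).sub ((K1r_int t).const_mul 2)) hlim
  rw [MeasureTheory.integral_sub (Jr_int t) ((K1r_int t).const_mul 2),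
    MeasureTheory.integral_const_mul] at this
  simp only [zero_div, sub_zero] at this
  unfold Jr
  linarith

lemma P0_deriv_real (t : ℝ) : HasDerivAt P0 (-(Jr t : ℂ)) (t:ℂ) := by
  have h := P0_hasDerivAt (im_real t)
  refine h.congr_deriv ?_
  simp only [K1_real]
  rw [integral_complex_ofReal, MeasureTheory.integral_neg, ← by_parts t]
  push_cast; ring

lemma Fr_two_neg : Fr 2 < 0 := by
  have h : 0 < ∫ u in Ioi (0:ℝ), -(u ^ 2 / Sr 2 u - 1) := by
    refine pos_int (fun u => ?_) (Fr_int 2).neg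
    rw [neg_pos, sub_neg, div_lt_one (Sr_pos _ _)]
    apply Real.lt_sqrt_of_sq_lt
    nlinarith [sq_nonneg u]
  rw [MeasureTheory.integral_neg] at h
  unfold Fr
  linarith

lemma Fr_neg_two_pos : 0 < Fr (-2) := by
  have hi := Fr_int (-2)
  have hsplit : (∫ u in Ioi (0:ℝ), (u ^ 2 / Sr (-2) u - 1)) =
      (∫ u in (0:ℝ)..2, (u ^ 2 / Sr (-2) u - 1)) + ∫ u in Ioi (2:ℝ), (u ^ 2 / Sr (-2) u - 1) := by
    rw [intervalIntegral.integral_of_le (by norm_num : (0:ℝ) ≤ 2),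
      ← MeasureTheory.setIntegral_union (Ioc_disjoint_Ioi le_rfl) measurableSet_Ioi
        (hi.mono_set Ioc_subset_Ioi_self) (hi.mono_set (Ioi_subset_Ioi (by norm_num))),
      Ioc_union_Ioi_eq_Ioi (by norm_num)]
  have hcont : Continuous fun u => u ^ 2 / Sr (-2) u - 1 :=
    (Continuous.div (by fun_prop) (Sr_cont _) (fun u => (Sr_pos _ u).ne')).sub continuous_const
  have h1 : (∫ u in (0:ℝ)..2, (447 / 1000 * u ^ 2 - 1)) ≤ ∫ u in (0:ℝ)..2, (u ^ 2 / Sr (-2) u - 1) := by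
    refine intervalIntegral.integral_mono_on (by norm_num)
      (Continuous.intervalIntegrable (by fun_prop) _ _) (hcont.intervalIntegrable _ _) fun u hu => ?_
    have hu4 : u ^ 2 ≤ 4 := by nlinarith [hu.1, hu.2]
    have hS : Sr (-2) u ≤ 1000 / 447 := by
      apply Real.sqrt_le_iff.mpr
      constructor
      · norm_num
      · nlinarith [sq_nonneg u]
    have hp := Sr_pos (-2) u
    have : 447 / 1000 * u ^ 2 ≤ u ^ 2 / Sr (-2) u := by
      rw [le_div_iff₀ hp]
      nlinarith [sq_nonneg u, mul_le_mul_of_nonneg_left hS (sq_nonneg u)]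
    linarith
  have h1' : (∫ u in (0:ℝ)..2, (447 / 1000 * u ^ 2 - 1 : ℝ)) = 447 / 1000 * (8 / 3) - 2 := by
    rw [intervalIntegral.integral_sub (Continuous.intervalIntegrable (by fun_prop) _ _)
      (Continuous.intervalIntegrable (by fun_prop) _ _), intervalIntegral.integral_const_mul,
      integral_pow]
    norm_num
  have hr : MeasureTheory.IntegrableOn (fun u : ℝ => 7 / 4 * u ^ (-2 : ℝ)) (Ioi 2) :=
    (integrableOn_Ioi_rpow_of_lt (by norm_num) (by norm_num)).const_mul _
  have h2 : (∫ u in Ioi (2:ℝ), 7 / 4 * u ^ (-2 : ℝ)) ≤ ∫ u in Ioi (2:ℝ), (u ^ 2 / Sr (-2) u - 1) := by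
    refine MeasureTheory.setIntegral_mono_on hr (hi.mono_set (Ioi_subset_Ioi (by norm_num)))
      measurableSet_Ioi fun u hu => ?_
    have hu : 2 < u := hu
    have hp := Sr_pos (-2) u
    have hS : Sr (-2) u ≤ u ^ 2 - 7 / 4 := by
      apply Real.sqrt_le_iff.mpr
      constructor
      · nlinarith
      · nlinarith
    have hu0 : (0:ℝ) < u := by linarith
    rw [Real.rpow_neg hu0.le, Real.rpow_ofNat]
    have hq : 0 < u ^ 2 - 7 / 4 := by nlinarith
    calc 7 / 4 * (u ^ 2)⁻¹ ≤ u ^ 2 / (u ^ 2 - 7 / 4) - 1 := by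
          rw [le_sub_iff_add_le, le_div_iff₀ hq, ← sub_nonneg]
          have : u ^ 2 - (7 / 4 * (u ^ 2)⁻¹ + 1) * (u ^ 2 - 7 / 4) = (49 / 16) * (u ^ 2)⁻¹ := by
            field_simp; ring
          rw [this]; positivity
      _ ≤ _ := by gcongr
  have h2' : (∫ u in Ioi (2:ℝ), 7 / 4 * u ^ (-2 : ℝ)) = 7 / 8 := by
    rw [MeasureTheory.integral_const_mul, integral_Ioi_rpow_of_lt (by norm_num) (by norm_num)]
    norm_num
  unfold Fr
  rw [hsplit]
  rw [h1'] at h1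
  rw [h2'] at h2
  linarith

lemma P0_analytic (t0 : ℝ) : AnalyticAt ℝ (fun t : ℝ => P0 t) t0 := by
  refine analyticAt_of_complex (ε := 1 / 2) (by norm_num) fun t ht => ?_
  refine (P0_hasDerivAt ?_).differentiableAt
  rw [mem_ball, dist_eq_norm] at ht
  refine lt_of_le_of_lt ?_ ht
  have := Complex.abs_im_le_norm (t - t0)
  simpa using this


lemma csq_re_pos {z : ℂ} (hz : 0 < z.re) : 0 < (csq z).re := by
  have hne : z ≠ 0 := by rintro rfl; simp at hz
  have h2 := congrArg Complex.re (csq_sq hne)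
  rw [sq, Complex.mul_re] at h2
  have := csq_re_nonneg z
  rcases this.lt_or_eq with h | h
  · exact h
  · rw [← h] at h2
    nlinarith [mul_self_nonneg (csq z).im]

lemma denom_norm {z : ℂ} (hz : 1 ≤ z.re) (u : ℝ) : 1 + u ^ 2 ≤ ‖z + (u:ℂ) ^ 2‖ := by
  refine le_trans ?_ (Complex.re_le_norm _)
  rw [← Complex.ofReal_pow, Complex.add_re, Complex.ofReal_re]
  linarith

lemma sqrt_kernel_bound {z : ℂ} (hz : 1 ≤ z.re) (u : ℝ) :
    ‖z / (z + (u:ℂ) ^ 2)‖ ≤ ‖z‖ * (1 + u ^ 2)⁻¹ := by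
  rw [norm_div, ← div_eq_mul_inv]
  have := denom_norm hz u
  gcongr

lemma sqrt_kernel_ne {z : ℂ} (hz : 1 ≤ z.re) (u : ℝ) : z + (u:ℂ) ^ 2 ≠ 0 :=
  norm_pos_iff.mp (lt_of_lt_of_le (by positivity) (denom_norm hz u))

lemma sqrt_rep {z : ℂ} (hz : 1 ≤ z.re) :
    ∫ u in Ioi (0:ℝ), z / (z + (u:ℂ) ^ 2) = (Real.pi : ℂ) / 2 * csq z := by
  have hz0 : 0 < z.re := by linarith
  have hne : z ≠ 0 := by rintro rfl; simp at hz0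
  set w := csq z with hw
  have hw2 : w ^ 2 = z := csq_sq hne
  have hwr : 0 < w.re := csq_re_pos hz0
  have m1 : ∀ u : ℝ, w + I * u ∈ slitPlane := fun u => Or.inl (by simpa using hwr)
  have m2 : ∀ u : ℝ, w - I * u ∈ slitPlane := fun u => Or.inl (by simpa using hwr)
  let G : ℝ → ℂ := fun u => w / (2 * I) * (Complex.log (w + I * u) - Complex.log (w - I * u))
  have hG : ∀ u : ℝ, HasDerivAt G (z / (z + (u:ℂ) ^ 2)) u := by
    intro u
    have hu : HasDerivAt (fun u : ℝ => I * (u:ℂ)) I u := by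
      simpa using (Complex.ofRealCLM.hasDerivAt (x := u)).const_mul I
    have h1 := (hu.const_add w).clog_real (m1 u)
    have h2 := (hu.const_sub w).clog_real (m2 u)
    refine ((h1.sub h2).const_mul (w / (2 * I))).congr_deriv ?_
    have n1 := Complex.slitPlane_ne_zero (m1 u)
    have n2 := Complex.slitPlane_ne_zero (m2 u)
    have n3 := sqrt_kernel_ne hz u
    have e : z + (u:ℂ) ^ 2 = (w + I * u) * (w - I * u) := by
      rw [← hw2]; linear_combination (u:ℂ) ^ 2 * Complex.I_sq
    rw [e]
    have := Complex.I_ne_zero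
    field_simp
    rw [← hw2]
    ring
  have hlim : Tendsto G atTop (𝓝 ((Real.pi : ℂ) / 2 * w)) := by
    have hz' : Tendsto (fun u : ℝ => w * ((u⁻¹ : ℝ) : ℂ)) atTop (𝓝 0) := by
      have := (Complex.continuous_ofReal.tendsto 0).comp tendsto_inv_atTop_zero
      simpa using this.const_mul w
    have l1 : Tendsto (fun u : ℝ => Complex.log (w * ((u⁻¹ : ℝ) : ℂ) + I)) atTop
        (𝓝 (Complex.log I)) := by
      have : Tendsto (fun u : ℝ => w * ((u⁻¹ : ℝ) : ℂ) + I) atTop (𝓝 I) := by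
        simpa using hz'.add_const I
      exact this.clog (Or.inr (by simp))
    have l2 : Tendsto (fun u : ℝ => Complex.log (w * ((u⁻¹ : ℝ) : ℂ) - I)) atTop
        (𝓝 (Complex.log (-I))) := by
      have : Tendsto (fun u : ℝ => w * ((u⁻¹ : ℝ) : ℂ) - I) atTop (𝓝 (-I)) := by
        simpa using hz'.sub_const I
      exact this.clog (Or.inr (by simp))
    have l3 := (l1.sub l2).const_mul (w / (2 * I))
    have e : w / (2 * I) * (Complex.log I - Complex.log (-I)) = (Real.pi : ℂ) / 2 * w := by
      rw [Complex.log_I, Complex.log_neg_I]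
      have := Complex.I_ne_zero
      field_simp
      ring
    rw [e] at l3
    refine l3.congr' ?_
    filter_upwards [eventually_gt_atTop 0] with u hu
    have huc : (u:ℂ) ≠ 0 := by exact_mod_cast hu.ne'
    have a1 : w + I * u = (u:ℂ) * (w * ((u⁻¹ : ℝ) : ℂ) + I) := by
      push_cast; field_simp
    have a2 : w - I * u = (u:ℂ) * (w * ((u⁻¹ : ℝ) : ℂ) - I) := by
      push_cast; field_simp
    have n1 : w * ((u⁻¹ : ℝ) : ℂ) + I ≠ 0 := fun h => Complex.slitPlane_ne_zero (m1 u) (by rw [a1, h, mul_zero])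
    have n2 : w * ((u⁻¹ : ℝ) : ℂ) - I ≠ 0 := fun h => Complex.slitPlane_ne_zero (m2 u) (by rw [a2, h, mul_zero])
    simp only [G]
    rw [a1, a2, Complex.log_ofReal_mul hu n1, Complex.log_ofReal_mul hu n2]
    ring
  have hIntg : MeasureTheory.IntegrableOn (fun u : ℝ => z / (z + (u:ℂ) ^ 2)) (Ioi 0) := by
    refine (bound_int ‖z‖).mono' (Continuous.aestronglyMeasurable ?_)
      (Eventually.of_forall fun u => sqrt_kernel_bound hz u)
    exact Continuous.div continuous_const (by fun_prop) (sqrt_kernel_ne hz)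
  have := MeasureTheory.integral_Ioi_of_hasDerivAt_of_tendsto' (a := 0) (fun u _ => hG u) hIntg hlim
  rw [this]
  simp [G]

def zt (s : ℝ) : ℂ := Complex.exp (2 * Real.pi * I * s)

lemma zt_ne (s : ℝ) : zt s ≠ 0 := Complex.exp_ne_zero _
lemma zt_norm (s : ℝ) : ‖zt s‖ = 1 := by
  unfold zt
  rw [show (2 * Real.pi * I * s : ℂ) = ((2 * Real.pi * s : ℝ) : ℂ) * I by push_cast; ring]
  exact Complex.norm_exp_ofReal_mul_I _
lemma zt_cont : Continuous zt := by unfold zt; fun_prop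
lemma zt_inv (s : ℝ) : (zt s)⁻¹ = zt (1 - s) := by
  unfold zt
  rw [← Complex.exp_neg, show (2 * Real.pi * I * ((1 - s : ℝ) : ℂ) : ℂ) =
    -(2 * Real.pi * I * s) + 2 * Real.pi * I by push_cast; ring, Complex.exp_periodic]

lemma one_sub_ne {c : ℂ} (hc : ‖c‖ < 1) : 1 - c ≠ 0 := by
  intro h
  have : c = 1 := (sub_eq_zero.mp h).symm
  rw [this, norm_one] at hc
  exact lt_irrefl _ hc

lemma cz_norm {c : ℂ} (hc : ‖c‖ < 1) (s : ℝ) : ‖c * zt s‖ < 1 := by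
  rw [norm_mul, zt_norm, mul_one]; exact hc

lemma mean_one {c : ℂ} (hc : ‖c‖ < 1) : ∫ s in (0:ℝ)..1, (1 - c * zt s)⁻¹ = 1 := by
  have hd : DiffContOnCl ℂ (fun w : ℂ => (1 - c * w)⁻¹) (ball 0 |1|) := by
    apply DifferentiableOn.diffContOnCl
    intro w hw
    rw [abs_one, closure_ball _ one_ne_zero, mem_closedBall_zero_iff] at hw
    have h1 : DifferentiableAt ℂ (fun w => 1 - c * w) w := by fun_prop
    refine (h1.inv (one_sub_ne ?_)).differentiableWithinAt
    rw [norm_mul]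
    nlinarith [norm_nonneg c, norm_nonneg w]
  have h := hd.circleAverage
  unfold Real.circleAverage at h
  have h2 := intervalIntegral.integral_comp_mul_left (a := 0) (b := 1)
    (fun θ => (1 - c * circleMap 0 1 θ)⁻¹) (c := 2 * Real.pi) (by positivity)
  rw [mul_zero, mul_one, h, mul_zero, sub_zero, inv_one] at h2
  refine Eq.trans ?_ h2
  refine intervalIntegral.integral_congr fun s _ => ?_
  have : zt s = circleMap 0 1 (2 * Real.pi * s) := by
    unfold zt circleMap
    push_cast
    rw [zero_add, one_mul]
    congr 1
    ring
  simp only [this]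

lemma mean_one' {c : ℂ} (hc : ‖c‖ < 1) : ∫ s in (0:ℝ)..1, (1 - c * (zt s)⁻¹)⁻¹ = 1 := by
  have := intervalIntegral.integral_comp_sub_left (a := 0) (b := 1)
    (fun s => (1 - c * zt s)⁻¹) 1
  simp only [zt_inv]
  rw [this]
  simpa using mean_one hc


def rr : ℝ := (1 + Real.sqrt 5) / 2

lemma rr_sq : rr ^ 2 = rr + 1 := by
  unfold rr
  have := Real.sq_sqrt (show (0:ℝ) ≤ 5 by norm_num)
  nlinarith

lemma rr_pos : 0 < rr := by unfold rr; positivity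

lemma rr_lt : rr < 2 := by nlinarith [rr_sq, rr_pos]
lemma rr_gt : 1 < rr := by nlinarith [rr_sq, rr_pos]

lemma rr_csq : (rr:ℂ) ^ 2 = rr + 1 := by exact_mod_cast rr_sq

def E1 (s : ℝ) : ℂ := I / 2 * (rr * zt s + (rr - 1) * (zt s)⁻¹)

lemma E1_cont : Continuous E1 := by
  unfold E1
  have h := zt_cont
  have h' : Continuous fun s => (zt s)⁻¹ := h.inv₀ zt_ne
  fun_prop

lemma zt_trig (s : ℝ) : zt s = Real.cos (2 * Real.pi * s) + Real.sin (2 * Real.pi * s) * I := by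
  unfold zt
  rw [show (2 * Real.pi * I * s : ℂ) = ((2 * Real.pi * s : ℝ) : ℂ) * I by push_cast; ring,
    Complex.exp_mul_I]
  push_cast; rfl

lemma zt_inv_trig (s : ℝ) :
    (zt s)⁻¹ = Real.cos (2 * Real.pi * s) - Real.sin (2 * Real.pi * s) * I := by
  refine inv_eq_of_mul_eq_one_right ?_
  rw [zt_trig]
  have h : ((Real.sin (2 * Real.pi * s) : ℝ) : ℂ) ^ 2 + ((Real.cos (2 * Real.pi * s) : ℝ) : ℂ) ^ 2 = 1 := by
    exact_mod_cast Real.sin_sq_add_cos_sq (2 * Real.pi * s)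
  linear_combination h - ((Real.sin (2 * Real.pi * s) : ℝ) : ℂ) ^ 2 * Complex.I_sq

def ell (b s : ℝ) : ℂ := ((-(1 / 2) * Real.sin (2 * Real.pi * s) : ℝ) : ℂ)
    + ((b * Real.cos (2 * Real.pi * s) : ℝ) : ℂ) * Complex.I

lemma ell_two : ell 2 = baseLoop := rfl

lemma E1_eq (s : ℝ) : E1 s = ell (rr - 1 / 2) s := by
  unfold E1 ell
  rw [zt_inv_trig, zt_trig]
  push_cast
  linear_combination (Complex.sin (2 * Real.pi * s)) / 2 * Complex.I_sq

lemma ell_re (b s : ℝ) : (ell b s).re = -(1 / 2) * Real.sin (2 * Real.pi * s) := by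
  unfold ell; simp only [Complex.add_re, Complex.ofReal_re, Complex.re_ofReal_mul, Complex.I_re]; ring
lemma ell_im (b s : ℝ) : (ell b s).im = b * Real.cos (2 * Real.pi * s) := by
  unfold ell; simp only [Complex.add_im, Complex.ofReal_im, Complex.im_ofReal_mul, Complex.I_im]; ring

lemma ell_re_le (b s : ℝ) : (ell b s).re ≤ 1 / 2 := by
  rw [ell_re]; nlinarith [Real.neg_one_le_sin (2 * Real.pi * s)]

lemma E1_re_le (s : ℝ) : (E1 s).re ≤ 1 / 2 := by rw [E1_eq]; exact ell_re_le _ _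

lemma inner_mean {a : ℝ} (ha : 3 / 2 ≤ a) :
    ∫ s in (0:ℝ)..1, ((a:ℂ) - E1 s)⁻¹ = ((Real.sqrt (a ^ 2 + 1) : ℝ) : ℂ)⁻¹ := by
  set S := Real.sqrt (a ^ 2 + 1) with hS
  have hS2 : S ^ 2 = a ^ 2 + 1 := Real.sq_sqrt (by positivity)
  have hSp : 0 < S := Real.sqrt_pos.mpr (by positivity)
  set p := S - a with hp
  have hp1 : p * (S + a) = 1 := by rw [hp]; nlinarith
  have hSa : 3 / 2 < S := by nlinarith
  have hp0 : 0 < p := by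
    by_contra h
    nlinarith
  have hp3 : p < 1 / 2 := by nlinarith
  have hpc : (p:ℂ) ^ 2 + 2 * a * p = 1 := by
    have : p ^ 2 + 2 * a * p = 1 := by rw [hp]; nlinarith
    exact_mod_cast this
  have hSc : (S:ℂ) = a + p := by rw [hp]; push_cast; ring
  have hpne : (p:ℂ) ≠ 0 := by exact_mod_cast hp0.ne'
  have hSne : (S:ℂ) ≠ 0 := by exact_mod_cast hSp.ne'
  have hr := rr_lt
  have hr1 := rr_gt
  have n1 : ‖I * p * rr‖ < 1 := by
    rw [norm_mul, norm_mul, Complex.norm_I, Complex.norm_real, Complex.norm_real,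
      Real.norm_of_nonneg hp0.le, Real.norm_of_nonneg rr_pos.le]
    nlinarith
  have n2 : ‖I * p * (rr - 1)‖ < 1 := by
    rw [show (rr:ℂ) - 1 = ((rr - 1 : ℝ) : ℂ) by push_cast; ring, norm_mul, norm_mul, Complex.norm_I,
      Complex.norm_real, Complex.norm_real,
      Real.norm_of_nonneg hp0.le, Real.norm_of_nonneg (by linarith)]
    nlinarith
  have key : ∀ s, ((a:ℂ) - E1 s)⁻¹ = (S:ℂ)⁻¹ * ((1 - I * p * rr * zt s)⁻¹ +
      (1 - I * p * (rr - 1) * (zt s)⁻¹)⁻¹ - 1) := by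
    intro s
    have hA := one_sub_ne (cz_norm n1 s)
    have hB : 1 - I * p * (rr - 1) * (zt s)⁻¹ ≠ 0 := by
      rw [zt_inv]; exact one_sub_ne (cz_norm n2 _)
    set A := 1 - I * p * rr * zt s with hAd
    set B := 1 - I * p * (rr - 1) * (zt s)⁻¹ with hBd
    have hz : zt s * (zt s)⁻¹ = 1 := mul_inv_cancel₀ (zt_ne s)
    have hAB : A * B = 2 * p * (a - E1 s) := by
      rw [hAd, hBd]; unfold E1
      linear_combination (I ^ 2 * p ^ 2 * rr * (rr - 1)) * hz + I ^ 2 * p ^ 2 * rr_csq +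
        (p:ℂ) ^ 2 * Complex.I_sq - hpc
    have hsum : A + B - A * B = 2 * p * S := by
      have : A + B - A * B = 1 - (1 - A) * (1 - B) := by ring
      rw [this, hAd, hBd, hSc]
      linear_combination -(I ^ 2 * p ^ 2 * rr * (rr - 1)) * hz - I ^ 2 * p ^ 2 * rr_csq -
        (p:ℂ) ^ 2 * Complex.I_sq - hpc
    have hne : (a:ℂ) - E1 s ≠ 0 := by
      intro h
      rw [h, mul_zero] at hAB
      exact mul_ne_zero hA hB hAB
    have h1 : A⁻¹ + B⁻¹ - 1 = (A + B - A * B) / (A * B) := by field_simp; ring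
    rw [h1, hsum, hAB]
    field_simp
  simp only [key]
  have hc1 : Continuous fun s => (1 - I * p * rr * zt s)⁻¹ :=
    Continuous.inv₀ (by have := zt_cont; fun_prop) fun s => one_sub_ne (cz_norm n1 s)
  have hc2 : Continuous fun s => (1 - I * p * (rr - 1) * (zt s)⁻¹)⁻¹ := by
    refine Continuous.inv₀ (continuous_const.sub (continuous_const.mul (zt_cont.inv₀ zt_ne))) fun s => ?_
    rw [zt_inv]; exact one_sub_ne (cz_norm n2 _)
  have hc12 : Continuous fun s => (1 - I * p * rr * zt s)⁻¹ +
      (1 - I * p * (rr - 1) * (zt s)⁻¹)⁻¹ := hc1.add hc2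
  rw [intervalIntegral.integral_const_mul, intervalIntegral.integral_sub
    (hc12.intervalIntegrable _ _) (continuous_const.intervalIntegrable _ _),
    intervalIntegral.integral_add (hc1.intervalIntegrable _ _) (hc2.intervalIntegrable _ _),
    mean_one n1, mean_one' n2]
  simp

lemma P0_circ {t : ℝ} (ht : 3 / 2 ≤ t) :
    P0 (t:ℂ) = -(Real.pi : ℂ) * ∫ s in (0:ℝ)..1, csq (t - E1 s) := by
  have hre : ∀ s, 1 ≤ ((t:ℂ) - E1 s).re := fun s => by
    have := E1_re_le s
    simp only [Complex.sub_re, Complex.ofReal_re]; linarith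
  let k : ℝ → ℝ → ℂ := fun s u => (t - E1 s) / ((t - E1 s) + (u:ℂ) ^ 2)
  have h1 : ∀ s, (Real.pi : ℂ) / 2 * csq (t - E1 s) = ∫ u in Ioi (0:ℝ), k s u :=
    fun s => (sqrt_rep (hre s)).symm
  have hkc : Continuous (Function.uncurry k) := by
    have := E1_cont
    refine Continuous.div (by fun_prop) (by fun_prop) fun x => sqrt_kernel_ne (hre x.1) x.2
  obtain ⟨M, hM⟩ : ∃ M, ∀ s ∈ Icc (0:ℝ) 1, ‖(t:ℂ) - E1 s‖ ≤ M := by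
    have := E1_cont
    exact isCompact_Icc.exists_bound_of_continuousOn (by fun_prop)
  have hM0 : 0 ≤ M := (norm_nonneg _).trans (hM 0 (by simp))
  have hIntg : MeasureTheory.Integrable (Function.uncurry k)
      ((MeasureTheory.volume.restrict (Ioc (0:ℝ) 1)).prod (MeasureTheory.volume.restrict (Ioi (0:ℝ)))) := by
    have hb : MeasureTheory.Integrable (fun x : ℝ × ℝ => (1:ℝ) * (M * (1 + x.2 ^ 2)⁻¹))
      ((MeasureTheory.volume.restrict (Ioc (0:ℝ) 1)).prod (MeasureTheory.volume.restrict (Ioi (0:ℝ)))) :=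
      MeasureTheory.Integrable.mul_prod (f := fun _ => (1:ℝ)) (MeasureTheory.integrable_const 1) (bound_int M)
    refine hb.mono' hkc.aestronglyMeasurable ?_
    rw [MeasureTheory.Measure.prod_restrict]
    refine (MeasureTheory.ae_restrict_iff' (measurableSet_Ioc.prod measurableSet_Ioi)).mpr
      (Eventually.of_forall fun x hx => ?_)
    rw [one_mul]
    refine (sqrt_kernel_bound (hre x.1) x.2).trans ?_
    have := hM x.1 (Ioc_subset_Icc_self hx.1)
    gcongr
  have hswap := MeasureTheory.integral_integral_swap hIntg
  have h3 : ∀ u : ℝ, (∫ s in Ioc (0:ℝ) 1, k s u) = -K0 (t:ℂ) u := by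
    intro u
    have ha : 3 / 2 ≤ t + u ^ 2 := by nlinarith [sq_nonneg u]
    have hm := inner_mean ha
    rw [← intervalIntegral.integral_of_le zero_le_one]
    have he : ∀ s, k s u = 1 - (u:ℂ) ^ 2 * (((t + u ^ 2 : ℝ) : ℂ) - E1 s)⁻¹ := by
      intro s
      have hn := sqrt_kernel_ne (hre s) u
      have e : ((t + u ^ 2 : ℝ) : ℂ) - E1 s = t - E1 s + (u:ℂ) ^ 2 := by push_cast; ring
      rw [e]
      simp only [k]
      field_simp
      ring
    simp only [he]
    have hc : Continuous fun s => (((t + u ^ 2 : ℝ) : ℂ) - E1 s)⁻¹ := by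
      refine Continuous.inv₀ (by have := E1_cont; fun_prop) fun s => ?_
      have hn := sqrt_kernel_ne (hre s) u
      have e : ((t + u ^ 2 : ℝ) : ℂ) - E1 s = t - E1 s + (u:ℂ) ^ 2 := by push_cast; ring
      rw [e]; exact hn
    have hc' : Continuous fun s => (u:ℂ) ^ 2 * (((t + u ^ 2 : ℝ) : ℂ) - E1 s)⁻¹ :=
      continuous_const.mul hc
    rw [intervalIntegral.integral_sub (continuous_const.intervalIntegrable _ _)
      (hc'.intervalIntegrable _ _), intervalIntegral.integral_const_mul, hm,
      K0_real]
    unfold Sr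
    push_cast
    simp
    ring
  rw [← intervalIntegral.integral_of_le zero_le_one] at hswap
  simp only [h3, ← h1] at hswap
  rw [intervalIntegral.integral_const_mul, MeasureTheory.integral_neg] at hswap
  unfold P0
  linear_combination 2 * hswap


def qz (z : ℂ) : ℂ := z * csq (1 + (z ^ 2)⁻¹)

def fq (t : ℝ) (z : ℂ) : ℂ := I * csq (t - z) / (2 * qz z)

def Uset (t : ℝ) : Set ℂ := {z | z ≠ 0 ∧ 1 + (z ^ 2)⁻¹ ∈ slitPlane ∧ (t:ℂ) - z ∈ slitPlane}

lemma Uset_open (t : ℝ) : IsOpen (Uset t) := by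
  have h1 : IsOpen {z : ℂ | z ≠ 0} := isOpen_ne
  have hc : ContinuousOn (fun z : ℂ => 1 + (z ^ 2)⁻¹) {z : ℂ | z ≠ 0} :=
    continuousOn_const.add (ContinuousOn.inv₀ (by fun_prop) fun z hz => pow_ne_zero 2 hz)
  have h2 := hc.isOpen_inter_preimage h1 Complex.isOpen_slitPlane
  have h3 : IsOpen ((fun z : ℂ => (t:ℂ) - z) ⁻¹' slitPlane) :=
    Complex.isOpen_slitPlane.preimage (by fun_prop)
  have := h2.inter h3
  convert this using 1
  ext z
  simp only [Uset, mem_ofPred_eq, mem_inter_iff, mem_preimage]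
  tauto

lemma qz_ne {z : ℂ} (hz : z ≠ 0) : qz z ≠ 0 := mul_ne_zero hz (csq_ne _)

lemma qz_sq {z : ℂ} (hz : z ≠ 0) (h : 1 + (z ^ 2)⁻¹ ∈ slitPlane) : qz z ^ 2 = z ^ 2 + 1 := by
  unfold qz
  rw [mul_pow, csq_sq (Complex.slitPlane_ne_zero h)]
  field_simp

lemma qz_differentiableAt {z : ℂ} (hz : z ≠ 0) (h : 1 + (z ^ 2)⁻¹ ∈ slitPlane) :
    DifferentiableAt ℂ qz z := by
  have h1 : DifferentiableAt ℂ (fun z : ℂ => 1 + (z ^ 2)⁻¹) z :=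
    ((differentiableAt_id.pow 2).inv (pow_ne_zero 2 hz)).const_add 1
  have h2 := (csq_hasDerivAt h).differentiableAt.comp z h1
  exact differentiableAt_id.mul h2

lemma fq_differentiableAt {t : ℝ} {z : ℂ} (hz : z ∈ Uset t) : DifferentiableAt ℂ (fq t) z := by
  obtain ⟨h0, h1, h2⟩ := hz
  have e1 : DifferentiableAt ℂ (fun z : ℂ => (t:ℂ) - z) z := by fun_prop
  have e2 := (csq_hasDerivAt h2).differentiableAt.comp z e1
  exact (e2.const_mul I).div ((qz_differentiableAt h0 h1).const_mul 2)
    (mul_ne_zero two_ne_zero (qz_ne h0))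

lemma fq_sq {t : ℝ} {z : ℂ} (hz : z ∈ Uset t) : fq t z ^ 2 = (z - t) / (4 * (z ^ 2 + 1)) := by
  obtain ⟨h0, h1, h2⟩ := hz
  unfold fq
  rw [div_pow, mul_pow, mul_pow, qz_sq h0 h1, csq_sq (Complex.slitPlane_ne_zero h2), Complex.I_sq]
  congr 1 <;> ring

lemma ell_mem {b t : ℝ} (hb : 1 < b) (ht : 1 / 2 < t) (s : ℝ) : ell b s ∈ Uset t := by
  have hr := ell_re b s
  have hi := ell_im b s
  have hsc := Real.sin_sq_add_cos_sq (2 * Real.pi * s)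
  have him : (ell b s).re = 0 → 1 < (ell b s).im ^ 2 := by
    intro h
    rw [h] at hr
    have h0 : Real.sin (2 * Real.pi * s) = 0 := by linarith
    rw [h0] at hsc
    rw [hi, mul_pow]
    nlinarith
  set z := ell b s with hz
  have hz0 : z ≠ 0 := by
    intro h
    have := him (by rw [h]; rfl)
    rw [h] at this
    norm_num at this
  refine ⟨hz0, ?_, Or.inl ?_⟩
  · by_contra hns
    rw [Complex.mem_slitPlane_iff] at hns
    push Not at hns
    obtain ⟨hx, hy⟩ := hns
    set w := 1 + (z ^ 2)⁻¹ with hw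
    have hwx : w = (w.re : ℂ) := by
      apply Complex.ext <;> simp [hy]
    have hprod : z ^ 2 * ((w.re - 1 : ℝ) : ℂ) = 1 := by
      push_cast
      rw [← hwx, hw]
      field_simp
      ring
    have a1 := congrArg Complex.re hprod
    have a2 := congrArg Complex.im hprod
    rw [Complex.re_mul_ofReal, sq, Complex.mul_re, Complex.one_re] at a1
    rw [Complex.im_mul_ofReal, sq, Complex.mul_im, Complex.one_im] at a2
    have hx1 : w.re - 1 ≠ 0 := by linarith
    have hri : z.re * z.im = 0 := by
      rcases mul_eq_zero.mp a2 with h | h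
      · linarith
      · exact absurd h hx1
    rcases mul_eq_zero.mp hri with h | h
    · have := him h
      rw [h] at a1
      nlinarith
    · rw [h] at a1
      nlinarith [mul_self_nonneg z.re]
  · have := ell_re_le b s
    rw [← hz] at this
    simp only [Complex.sub_re, Complex.ofReal_re]; linarith

lemma ell_contDiff (b : ℝ) : ContDiff ℝ 1 (ell b) := by
  unfold ell
  refine ContDiff.add ?_ (ContDiff.mul ?_ contDiff_const)
  · have h : ContDiff ℝ 1 fun s : ℝ => -(1 / 2) * Real.sin (2 * Real.pi * s) := by fun_prop
    exact Complex.ofRealCLM.contDiff.comp h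
  · have h : ContDiff ℝ 1 fun s : ℝ => b * Real.cos (2 * Real.pi * s) := by fun_prop
    exact Complex.ofRealCLM.contDiff.comp h

lemma ell_periodic (b : ℝ) : Function.Periodic (ell b) 1 := by
  intro s
  unfold ell
  rw [mul_add, mul_one, Real.sin_add_two_pi, Real.cos_add_two_pi]

lemma ell_dist (b b0 s : ℝ) : ‖ell b s - ell b0 s‖ ≤ |b - b0| := by
  have : ell b s - ell b0 s = (((b - b0) * Real.cos (2 * Real.pi * s) : ℝ) : ℂ) * I := by
    unfold ell; push_cast; ring
  rw [this, norm_mul, Complex.norm_I, mul_one, Complex.norm_real, Real.norm_eq_abs, abs_mul]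
  have := Real.abs_cos_le_one (2 * Real.pi * s)
  nlinarith [abs_nonneg (b - b0)]

lemma fq_ell_cont {b t : ℝ} (hb : 1 < b) (ht : 1 / 2 < t) : Continuous fun s => fq t (ell b s) :=
  continuous_iff_continuousAt.mpr fun s =>
    ContinuousAt.comp (f := ell b) (fq_differentiableAt (ell_mem hb ht s)).continuousAt
      (ell_contDiff b).continuous.continuousAt

def Jb (t b : ℝ) : ℂ := ∫ s in (0:ℝ)..1, fq t (ell b s) * deriv (ell b) s

lemma Jb_loc {b0 t : ℝ} (hb : 1 < b0) (ht : 1 / 2 < t) : ∀ᶠ b in 𝓝 b0, Jb t b = Jb t b0 := by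
  have hK : IsCompact (ell b0 '' Icc 0 1) := isCompact_Icc.image (ell_contDiff b0).continuous
  have hKU : ell b0 '' Icc 0 1 ⊆ Uset t := by
    rintro _ ⟨s, _, rfl⟩; exact ell_mem hb ht s
  obtain ⟨δ, hδ, hsub⟩ := hK.exists_thickening_subset_open (Uset_open t) hKU
  have hball : ∀ s, ball (ell b0 s) δ ⊆ Uset t := by
    intro s
    refine Subset.trans (ball_subset_thickening ?_ δ) hsub
    have : ell b0 s = ell b0 (Int.fract s) := (per_fract (ell_periodic b0) s).symm
    rw [this]
    exact mem_image_of_mem _ ⟨Int.fract_nonneg s, (Int.fract_lt_one s).le⟩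
  filter_upwards [ball_mem_nhds b0 hδ, lt_mem_nhds hb] with b hbd hb1
  refine close_loops (ell b0) (ell b) (ell_contDiff _) (ell_contDiff _) (ell_periodic _)
    (ell_periodic _) δ hδ (fun s => ?_) (fun _ => fq t)
    (fun s z hz => (fq_differentiableAt (hball s hz)).differentiableWithinAt)
    (fun s => Eventually.of_forall fun _ _ _ => rfl) rfl (fq_ell_cont hb ht) (fq_ell_cont hb1 ht)
  rw [mem_ball, dist_eq_norm]
  exact lt_of_le_of_lt (ell_dist b b0 s) hbd

lemma Jb_const {b b' t : ℝ} (hb : 1 < b) (hb' : 1 < b') (ht : 1 / 2 < t) : Jb t b = Jb t b' := by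
  have hd : ∀ x ∈ Ioi (1:ℝ), HasDerivAt (Jb t) 0 x := fun x hx =>
    (hasDerivAt_const x (Jb t x)).congr_of_eventuallyEq (Jb_loc hx ht)
  exact isOpen_Ioi.is_const_of_deriv_eq_zero isPreconnected_Ioi
    (fun z hz => (hd z hz).differentiableAt.differentiableWithinAt)
    (fun z hz => (hd z hz).deriv) hb hb'

lemma rr_half_gt : 1 < rr - 1 / 2 := by nlinarith [rr_sq, rr_pos]

def qE (s : ℝ) : ℂ := I / 2 * (rr * zt s - (rr - 1) * (zt s)⁻¹)

lemma E1_fun : E1 = ell (rr - 1 / 2) := funext E1_eq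

lemma zt_hasDerivAt (s : ℝ) : HasDerivAt zt (2 * Real.pi * I * zt s) s := by
  have h : HasDerivAt (fun s : ℝ => (2 * Real.pi * I * (s:ℂ) : ℂ)) (2 * Real.pi * I) s := by
    simpa using (Complex.ofRealCLM.hasDerivAt (x := s)).const_mul (2 * Real.pi * I : ℂ)
  refine h.cexp.congr_deriv ?_
  unfold zt; ring

lemma E1_hasDerivAt (s : ℝ) : HasDerivAt E1 (2 * Real.pi * I * qE s) s := by
  have h1 := zt_hasDerivAt s
  have h2 := h1.inv (zt_ne s)
  refine (((h1.const_mul (rr:ℂ)).add (h2.const_mul ((rr:ℂ) - 1))).const_mul (I / 2)).congr_deriv ?_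
  unfold qE
  have := zt_ne s
  field_simp
  ring

lemma qE_sq (s : ℝ) : qE s ^ 2 = E1 s ^ 2 + 1 := by
  unfold qE E1
  have hz : zt s * (zt s)⁻¹ = 1 := mul_inv_cancel₀ (zt_ne s)
  linear_combination -I ^ 2 * rr * (rr - 1) * hz - I ^ 2 * rr_csq - Complex.I_sq

lemma E1_mem (s : ℝ) : E1 s ≠ 0 ∧ 1 + ((E1 s) ^ 2)⁻¹ ∈ slitPlane := by
  have := ell_mem (t := 2) rr_half_gt (by norm_num) s
  rw [← E1_eq] at this
  exact ⟨this.1, this.2.1⟩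

lemma zt_zero : zt 0 = 1 := by simp [zt]

lemma qz_E1 (s : ℝ) : qz (E1 s) = qE s := by
  have hc1 : Continuous fun s => qz (E1 s) := continuous_iff_continuousAt.mpr fun s =>
    ContinuousAt.comp (f := E1) (qz_differentiableAt (E1_mem s).1 (E1_mem s).2).continuousAt
      E1_cont.continuousAt
  have hc2 : Continuous qE := by
    unfold qE
    exact continuous_const.mul ((continuous_const.mul zt_cont).sub
      (continuous_const.mul (zt_cont.inv₀ zt_ne)))
  have hne : ∀ s, qE s ≠ 0 := fun s h => by
    have h1 := qE_sq s
    rw [← qz_sq (E1_mem s).1 (E1_mem s).2, h] at h1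
    exact qz_ne (E1_mem s).1 (pow_eq_zero_iff two_ne_zero |>.mp (by rw [← h1]; ring))
  have h0 : qz (E1 0) = qE 0 := by
    have e : E1 0 = I * ((Real.sqrt 5 / 2 : ℝ) : ℂ) := by
      unfold E1 rr; rw [zt_zero]; push_cast; ring
    have e2 : qE 0 = I / 2 := by unfold qE; rw [zt_zero]; ring
    have h5 : ((Real.sqrt 5 / 2 : ℝ) : ℂ) ^ 2 = 5 / 4 := by
      have : (Real.sqrt 5 / 2) ^ 2 = 5 / 4 := by
        rw [div_pow, Real.sq_sqrt (by norm_num)]; norm_num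
      rw [← Complex.ofReal_pow, this]; norm_num
    rw [e2, e]
    unfold qz
    rw [mul_pow, h5, Complex.I_sq, show (1 + (-1 * (5 / 4 : ℂ))⁻¹) = ((1 / 5 : ℝ) : ℂ) by norm_num,
      csq_ofReal (by norm_num), mul_assoc, ← Complex.ofReal_mul, Real.sqrt_div (by norm_num),
      Real.sqrt_one]
    have : Real.sqrt 5 ≠ 0 := by positivity
    rw [show Real.sqrt 5 / 2 * (1 / Real.sqrt 5) = 1 / 2 by field_simp]
    push_cast; ring
  exact isPreconnected_univ.eq_of_sq_eq hc1.continuousOn hc2.continuousOn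
    (fun s _ => by
      simp only [Pi.pow_apply]
      rw [qz_sq (E1_mem s).1 (E1_mem s).2, qE_sq]) (fun {s} _ => hne s) (mem_univ 0) h0 (mem_univ s)

lemma base_int {t : ℝ} (ht : 3 / 2 ≤ t) :
    ∫ s in (0:ℝ)..1, fq t (baseLoop s) * deriv baseLoop s = P0 t := by
  have h := Jb_const (b := 2) (b' := rr - 1 / 2) (t := t) (by norm_num) rr_half_gt (by linarith)
  unfold Jb at h
  rw [ell_two, ← E1_fun] at h
  rw [h, P0_circ ht, ← intervalIntegral.integral_const_mul]
  refine intervalIntegral.integral_congr fun s _ => ?_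
  change fq t (E1 s) * deriv E1 s = -(Real.pi : ℂ) * csq (t - E1 s)
  rw [(E1_hasDerivAt s).deriv]
  unfold fq
  rw [← qz_E1]
  have := qz_ne (E1_mem s).1
  field_simp
  linear_combination (csq (t - E1 s)) * Complex.I_sq


lemma csq_mul_pos {r : ℝ} (hr : 0 < r) {z : ℂ} (hz : z ≠ 0) :
    csq (r * z) = (Real.sqrt r : ℂ) * csq z := by
  rw [← csq_ofReal hr]
  unfold csq
  rw [Complex.log_ofReal_mul hr hz, add_div, Complex.exp_add, Complex.ofReal_log hr.le]

lemma base_zero : baseLoop 0 = 2 * I := by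
  simp [baseLoop]

lemma fq_base : fq 2 (2 * I) = (((2 : ℂ) - 2 * Complex.I) / 12) ^ ((1 : ℂ) / 2) := by
  have hne : (2:ℂ) - 2 * I ≠ 0 := by
    intro h
    have := congrArg Complex.re h
    simp at this
  rw [Complex.cpow_def_of_ne_zero (div_ne_zero hne (by norm_num)), mul_one_div]
  change _ = csq _
  rw [show ((2:ℂ) - 2 * I) / 12 = ((1 / 12 : ℝ) : ℂ) * (2 - 2 * I) by push_cast; ring,
    csq_mul_pos (by norm_num) hne]
  unfold fq qz
  rw [mul_pow, Complex.I_sq, show (1 + ((2:ℂ) ^ 2 * -1)⁻¹) = ((3 / 4 : ℝ) : ℂ) by norm_num,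
    csq_ofReal (by norm_num)]
  have h : Real.sqrt (1 / 12) * Real.sqrt (3 / 4) = 1 / 4 := by
    rw [← Real.sqrt_mul (by norm_num), show (1 / 12 * (3 / 4) : ℝ) = (1 / 4) ^ 2 by norm_num,
      Real.sqrt_sq (by norm_num)]
  have hc : ((Real.sqrt (1 / 12) : ℝ) : ℂ) * ((Real.sqrt (3 / 4) : ℝ) : ℂ) = 1 / 4 := by
    rw [← Complex.ofReal_mul, h]; norm_num
  have hs : ((Real.sqrt (3 / 4) : ℝ) : ℂ) ≠ 0 := by
    intro h0; rw [h0, mul_zero] at hc; norm_num at hc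
  rw [div_eq_iff (by simp only [ne_eq, mul_eq_zero]; simp)]
  push_cast
  linear_combination (-4 * I * csq (2 - 2 * I)) * hc

lemma base_mem {t : ℝ} (ht : 1 / 2 < t) (s : ℝ) : baseLoop s ∈ Uset t := by
  rw [← ell_two]; exact ell_mem (by norm_num) ht s

lemma base_cont : Continuous baseLoop := by rw [← ell_two]; exact (ell_contDiff 2).continuous

lemma base_far (s : ℝ) : 3 / 2 ≤ ‖baseLoop s - ((2:ℝ):ℂ)‖ := by
  have h := ell_re_le 2 s
  rw [ell_two] at h
  have h2 := Complex.abs_re_le_norm (baseLoop s - ((2:ℝ):ℂ))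
  rw [Complex.sub_re, Complex.ofReal_re, abs_of_nonpos (by linarith)] at h2
  linarith

lemma match_branch {g0 : ℝ → ℂ} (hgc : Continuous g0)
    (hg : ∀ s, g0 s ^ 2 = (baseLoop s - ((2:ℝ):ℂ)) / (4 * (baseLoop s ^ 2 + 1)))
    (h0 : g0 0 = (((2 : ℂ) - 2 * Complex.I) / 12) ^ ((1 : ℂ) / 2)) {t : ℝ}
    (ht : t ∈ ball (2:ℝ) (1 / 2)) (s : ℝ) :
    g0 s * csq ((baseLoop s - t) / (baseLoop s - ((2:ℝ):ℂ))) = fq t (baseLoop s) := by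
  let S : Set (ℝ × ℝ) := ball (2:ℝ) (1 / 2) ×ˢ univ
  have hS : IsPreconnected S := (convex_ball (2:ℝ) (1 / 2)).isPreconnected.prod isPreconnected_univ
  have hB := base_cont
  have hfar0 : ∀ s, baseLoop s - ((2:ℝ):ℂ) ≠ 0 := fun s =>
    norm_pos_iff.mp (lt_of_lt_of_le (by norm_num) (base_far s))
  have htt : ∀ x ∈ S, 3 / 2 < x.1 := fun x hx => by
    have := hx.1
    rw [mem_ball, Real.dist_eq, abs_lt] at this
    linarith [this.1]
  have hsl : ∀ x ∈ S, (baseLoop x.2 - x.1) / (baseLoop x.2 - ((2:ℝ):ℂ)) ∈ slitPlane := by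
    intro x hx
    apply ratio_mem
    have h1 := hx.1
    rw [mem_ball, Real.dist_eq] at h1
    rw [show baseLoop x.2 - (x.1:ℂ) - (baseLoop x.2 - ((2:ℝ):ℂ)) = -((x.1 - 2 : ℝ) : ℂ) by
      push_cast; ring, norm_neg, Complex.norm_real, Real.norm_eq_abs]
    linarith [base_far x.2]
  have hmem : ∀ x ∈ S, baseLoop x.2 ∈ Uset x.1 := fun x hx =>
    base_mem (by linarith [htt x hx]) x.2
  have c1 : ContinuousOn (fun x : ℝ × ℝ => g0 x.2 *
      csq ((baseLoop x.2 - x.1) / (baseLoop x.2 - ((2:ℝ):ℂ)))) S := by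
    intro x hx
    refine (ContinuousAt.mul (by fun_prop) ?_).continuousWithinAt
    refine ContinuousAt.comp (g := csq) (csq_continuousAt (hsl x hx)) ?_
    exact ContinuousAt.div (by fun_prop) (by fun_prop) (hfar0 _)
  have c2 : ContinuousOn (fun x : ℝ × ℝ => fq x.1 (baseLoop x.2)) S := by
    intro x hx
    obtain ⟨m0, m1, m2⟩ := hmem x hx
    have a1 : ContinuousAt (fun x : ℝ × ℝ => csq ((x.1:ℂ) - baseLoop x.2)) x :=
      ContinuousAt.comp (g := csq) (csq_continuousAt m2) (by fun_prop)
    have a2 : ContinuousAt (fun x : ℝ × ℝ => qz (baseLoop x.2)) x :=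
      ContinuousAt.comp (g := qz) (qz_differentiableAt m0 m1).continuousAt (by fun_prop)
    unfold fq
    exact ((continuousAt_const.mul a1).div (continuousAt_const.mul a2)
      (mul_ne_zero two_ne_zero (qz_ne m0))).continuousWithinAt
  have hne : ∀ x ∈ S, fq x.1 (baseLoop x.2) ≠ 0 := fun x hx =>
    div_ne_zero (mul_ne_zero Complex.I_ne_zero (csq_ne _))
      (mul_ne_zero two_ne_zero (qz_ne (hmem x hx).1))
  have hsq : EqOn ((fun x : ℝ × ℝ => g0 x.2 *
      csq ((baseLoop x.2 - x.1) / (baseLoop x.2 - ((2:ℝ):ℂ)))) ^ 2)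
      ((fun x : ℝ × ℝ => fq x.1 (baseLoop x.2)) ^ 2) S := by
    intro x hx
    simp only [Pi.pow_apply]
    rw [fq_sq (hmem x hx), mul_pow, hg, csq_sq (Complex.slitPlane_ne_zero (hsl x hx))]
    have := hfar0 x.2
    field_simp
  have hb : (fun x : ℝ × ℝ => g0 x.2 *
      csq ((baseLoop x.2 - x.1) / (baseLoop x.2 - ((2:ℝ):ℂ)))) ((2:ℝ), (0:ℝ)) =
      (fun x : ℝ × ℝ => fq x.1 (baseLoop x.2)) ((2:ℝ), (0:ℝ)) := by
    simp only
    rw [div_self (hfar0 0), csq_one, mul_one, h0, base_zero, fq_base]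
  have h2S : ((2:ℝ), (0:ℝ)) ∈ S := ⟨mem_ball_self (by norm_num), mem_univ _⟩
  have htS : (t, s) ∈ S := ⟨ht, mem_univ _⟩
  exact hS.eq_of_sq_eq c1 c2 hsq (fun {x} hx => hne x hx) h2S hb htS


/-- Fix `e₂ = i`, `e₃ = -i` and for real `t` let
`Φ(t) = ∮_γ √((E-t)/(4(E²+1))) dE`, the contour integral over a closed contour
`γ` encircling `i` and `-i` (equivalently `t` and `∞`), the branch of the
square root being fixed (by continuity in `t` from the reference contour and
branch at `t = 2`) so that the integrand of `Φ'(t)` is positive on `(t,∞)`.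
Then `Φ'(t) = -(1/2)∮_γ dE/√(4(E²+1)(E-t)) < 0` for all real `t`, so `Φ` is
strictly decreasing on `ℝ`; moreover `Φ(-2) > 0` and `Φ(2) < 0`, hence `Φ` has
exactly one real zero `t = t*`.

Here `Γ t` is the contour used for the parameter value `t`, `g t` is the
continuous branch of `√((E-t)/(4(E²+1)))` along it (so that
`g/(E-t) = 1/√(4(E²+1)(E-t))` is the coherent branch of the integrand of
`Φ'`), both depending continuously on `t`, normalised at `t = 2` by the
reference ellipse through `2i` and the principal square root there. -/
theorem period_integral_strictly_decreasing_unique_zero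
    (Γ : ℝ → ℝ → ℂ) (g : ℝ → ℝ → ℂ) (Φ Ψ : ℝ → ℂ)
    -- a continuous family of closed C¹ contours avoiding the branch points
    (hΓcont : Continuous (Function.uncurry Γ))
    (hΓloop : ∀ t : ℝ, ContDiff ℝ 1 (Γ t) ∧ Function.Periodic (Γ t) 1 ∧
      ∀ s : ℝ, Γ t s ≠ Complex.I ∧ Γ t s ≠ -Complex.I ∧ Γ t s ≠ (t : ℂ))
    -- each contour encircles `i` and `-i` exactly once
    (hwind : ∀ t : ℝ, windingNumber (Γ t) Complex.I = 1 ∧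
      windingNumber (Γ t) (-Complex.I) = 1)
    -- a continuous family of branches of `√((E-t)/(4(E²+1)))` along the contours
    (hgcont : Continuous (Function.uncurry g))
    (hg : ∀ t : ℝ, Function.Periodic (g t) 1 ∧
      ∀ s : ℝ, g t s ^ 2 = (Γ t s - (t : ℂ)) / (4 * ((Γ t s) ^ 2 + 1)))
    -- normalisation at `t = 2`: the reference ellipse, with `t = 2` outside,
    -- and the principal branch of the square root at the base point `2i`
    (hbaseΓ : Γ 2 = baseLoop)
    (hbasewind : windingNumber (Γ 2) ((2 : ℝ) : ℂ) = 0)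
    (hbaseg : g 2 0 = (((2 : ℂ) - 2 * Complex.I) / 12) ^ ((1 : ℂ) / 2))
    -- `Φ` and `Ψ` are the corresponding contour integrals
    (hΦ : ∀ t : ℝ, Φ t = ∫ s in (0:ℝ)..1, g t s * deriv (Γ t) s)
    (hΨ : ∀ t : ℝ, Ψ t = ∫ s in (0:ℝ)..1, g t s / (Γ t s - (t : ℂ)) * deriv (Γ t) s) :
    -- `Φ'(t) = -(1/2) ∮ dE/√(4(E²+1)(E-t))`, which is real and negative
    (∀ t : ℝ, HasDerivAt Φ (-(1 / 2) * Ψ t) t) ∧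
    (∀ t : ℝ, (Ψ t).im = 0 ∧ 0 < (Ψ t).re) ∧
    -- `Φ` is real and strictly monotonically decreasing on the whole real line
    (∀ t : ℝ, (Φ t).im = 0) ∧
    StrictAnti (fun t : ℝ => (Φ t).re) ∧
    -- `Φ(-2) > 0` and `Φ(2) < 0`
    0 < (Φ (-2)).re ∧ (Φ 2).re < 0 ∧
    -- hence `Φ` has exactly one real zero
    (∃! tst : ℝ, Φ tst = 0) := by
  have hΓc : ∀ t, Continuous (Γ t) := fun t => (hΓloop t).1.continuous
  have hdc : ∀ t, Continuous (deriv (Γ t)) := fun t => (hΓloop t).1.continuous_deriv le_rfl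
  have hgc : ∀ t, Continuous (g t) := fun t => by
    have : Continuous fun s => Function.uncurry g (t, s) := by fun_prop
    exact this
  have hΦf : Φ = fun t => ∫ s in (0:ℝ)..1, g t s * deriv (Γ t) s := funext hΦ
  -- local derivative and analyticity
  have hder : ∀ t : ℝ, HasDerivAt Φ (-(1 / 2) * Ψ t) t := by
    intro t0
    obtain ⟨δ, hd, hF, hrep⟩ := local_rep Γ g hΓcont hΓloop hgcont hg t0
    have h := (loc_hasDerivAt t0 (Γ t0) (g t0) (deriv (Γ t0)) (hΓc t0) (hgc t0) (hdc t0) δ hd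
      (fun s => (hF s).1) t0 (mem_ball_self (by linarith))).comp_ofReal
    have hrep' : Φ =ᶠ[𝓝 t0] fun t : ℝ => ∫ s in (0:ℝ)..1,
        g t0 s * csq ((Γ t0 s - t) / (Γ t0 s - t0)) * deriv (Γ t0) s := by
      rw [hΦf]; exact hrep
    refine (h.congr_of_eventuallyEq hrep').congr_deriv ?_
    rw [intervalIntegral.integral_const_mul, hΨ]
    congr 1
    refine intervalIntegral.integral_congr fun s _ => ?_
    have hn : Γ t0 s - (t0:ℂ) ≠ 0 := sub_ne_zero.mpr ((hΓloop t0).2.2 s).2.2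
    simp only [div_self hn, csq_one, mul_one]
  have hana : ∀ t : ℝ, AnalyticAt ℝ Φ t := by
    intro t0
    obtain ⟨δ, hd, hF, hrep⟩ := local_rep Γ g hΓcont hΓloop hgcont hg t0
    have h := analyticAt_of_complex (t0 := t0) (ε := δ / 2) (by linarith) (fun t ht =>
      (loc_hasDerivAt t0 (Γ t0) (g t0) (deriv (Γ t0)) (hΓc t0) (hgc t0) (hdc t0) δ hd
      (fun s => (hF s).1) t ht).differentiableAt)
    refine h.congr ?_
    rw [hΦf]
    filter_upwards [hrep] with t ht
    exact ht.symm
  -- identification with the explicit integral near `t = 2`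
  have hnear : Φ =ᶠ[𝓝 (2:ℝ)] fun t : ℝ => P0 t := by
    obtain ⟨δ, hd, hF, hrep⟩ := local_rep Γ g hΓcont hΓloop hgcont hg 2
    filter_upwards [hrep, ball_mem_nhds (2:ℝ) (by norm_num : (0:ℝ) < 1 / 2)] with t h1 ht
    have ht' : 3 / 2 ≤ t := by
      rw [mem_ball, Real.dist_eq, abs_lt] at ht
      linarith [ht.1]
    rw [hΦ, h1, ← base_int ht', hbaseΓ]
    refine intervalIntegral.integral_congr fun s _ => ?_
    have hgs : ∀ s, g 2 s ^ 2 = (baseLoop s - ((2:ℝ):ℂ)) / (4 * (baseLoop s ^ 2 + 1)) := by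
      intro s
      have := (hg 2).2 s
      rwa [hbaseΓ] at this
    have hm := match_branch (hgc 2) hgs hbaseg ht s
    rw [hm]
  have heq : ∀ t : ℝ, Φ t = (Fr t : ℂ) := by
    intro t
    rw [← P0_real]
    exact AnalyticOnNhd.eqOn_of_preconnected_of_eventuallyEq (𝕜 := ℝ) (U := univ)
      (fun x _ => hana x) (fun x _ => P0_analytic x) isPreconnected_univ (mem_univ 2) hnear (mem_univ t)
  have hΨJ : ∀ t : ℝ, Ψ t = ((2 * Jr t : ℝ) : ℂ) := by
    intro t
    have h1 : HasDerivAt Φ (-(Jr t : ℂ)) t := by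
      have : Φ = fun t : ℝ => P0 t := funext fun t => by rw [heq, P0_real]
      rw [this]
      exact (P0_deriv_real t).comp_ofReal
    have h2 := (hder t).unique h1
    push_cast
    linear_combination -2 * h2
  have hFder : ∀ t : ℝ, HasDerivAt Fr (-(Jr t)) t := by
    intro t
    have h1 : HasDerivAt P0 (((-(Jr t) : ℝ)) : ℂ) (t:ℂ) := by
      push_cast; exact P0_deriv_real t
    have h2 := h1.real_of_complex
    refine h2.congr_of_eventuallyEq (Eventually.of_forall fun x => ?_)
    simp only [P0_real, Complex.ofReal_re]
  have hanti : StrictAnti Fr := strictAnti_of_deriv_neg fun t => by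
    rw [(hFder t).deriv]
    linarith [Jr_pos t]
  have hre : (fun t : ℝ => (Φ t).re) = Fr := funext fun t => by rw [heq, Complex.ofReal_re]
  refine ⟨hder, fun t => ?_, fun t => ?_, ?_, ?_, ?_, ?_⟩
  · rw [hΨJ, Complex.ofReal_im, Complex.ofReal_re]
    exact ⟨rfl, by linarith [Jr_pos t]⟩
  · rw [heq, Complex.ofReal_im]
  · rw [hre]; exact hanti
  · rw [heq, Complex.ofReal_re]; exact Fr_neg_two_pos
  · rw [heq, Complex.ofReal_re]; exact Fr_two_neg
  · have hFc : Continuous Fr := continuous_iff_continuousAt.mpr fun t => (hFder t).continuousAt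
    obtain ⟨x, -, hx⟩ := intermediate_value_Icc' (by norm_num : (-2:ℝ) ≤ 2) hFc.continuousOn
      (show (0:ℝ) ∈ Icc (Fr 2) (Fr (-2)) from ⟨Fr_two_neg.le, Fr_neg_two_pos.le⟩)
    refine ⟨x, ?_, fun y hy => ?_⟩
    · change Φ x = 0
      rw [heq, hx, Complex.ofReal_zero]
    · change Φ y = 0 at hy
      rw [heq] at hy
      apply hanti.injective
      rw [hx]
      exact_mod_cast hy
end
end
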